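/- arXiv:funct-an/9609003 — 2 statements merged into one kernel-verified Lean document; each statement's English description precedes it below -/
import Mathlib

section
/- Let A be a C*-algebra whose multiplier C*-algebra M(A) is monotone complete, let M be a Hilbert A-module and N ⊆ M a Hilbert A-submodule. Then the biorthogonal complement N^⊥⊥ of N computed inside the A-bidual Hilbert A-module M'' (with respect to the extended inner product) is an orthogonal direct summand of M'': M'' = N^⊥⊥ ⊕ (N^⊥⊥)^⊥. -/
noncomputable section

open scoped ENNReal MultiplierAlgebra

universe u v w

/-- A (left) Hilbert C*-module over a (not necessarily unital) C*-algebra `A`: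
a Banach space `M` which is a (nonunital) left `A`-module equipped with an `A`-valued
inner product, `A`-linear in the first variable, satisfying `⟨x,y⟩ = ⟨y,x⟩*`,
`⟨x,x⟩ ≥ 0` (i.e. of the form `b* b`), definiteness, and such that the norm of `M`
satisfies `‖x‖ = ‖⟨x,x⟩‖ ^ (1/2)` and `M` is complete. -/
class HilbertCStarModule (A : Type u) (M : Type v) [NonUnitalCStarAlgebra A]
    [NormedAddCommGroup M] [NormedSpace ℂ M] [SMul A M] where
  inner : M → M → A
  smul_add' : ∀ (a : A) (x y : M), a • (x + y) = a • x + a • y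
  add_smul' : ∀ (a b : A) (x : M), (a + b) • x = a • x + b • x
  mul_smul' : ∀ (a b : A) (x : M), (a * b) • x = a • (b • x)
  smul_smul' : ∀ (c : ℂ) (a : A) (x : M), (c • a) • x = c • (a • x)
  inner_add_left : ∀ x y z : M, inner (x + y) z = inner x z + inner y z
  inner_smulA_left : ∀ (a : A) (x y : M), inner (a • x) y = a * inner x y
  inner_smulC_left : ∀ (c : ℂ) (x y : M), inner (c • x) y = c • inner x y
  inner_conj : ∀ x y : M, inner x y = star (inner y x)
  inner_self_pos : ∀ x : M, ∃ b : A, inner x x = star b * b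
  inner_self_eq_zero : ∀ x : M, inner x x = 0 ↔ x = 0
  norm_eq : ∀ x : M, ‖x‖ = Real.sqrt ‖inner x x‖
  complete : CompleteSpace M

section Defs

variable (A : Type u) [NonUnitalCStarAlgebra A] {M : Type v}
  [NormedAddCommGroup M] [NormedSpace ℂ M] [SMul A M]

/-- The `A`-valued inner product of a Hilbert C*-module. -/
def hInner [HilbertCStarModule A M] (x y : M) : A := HilbertCStarModule.inner x y

/-- The orthogonal complement `S^⊥ = {x | ⟨x, s⟩ = 0 for all s ∈ S}` of a subset `S`. -/
def orthComp [HilbertCStarModule A M] (S : Set M) : Set M :=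
  {x : M | ∀ s ∈ S, hInner A x s = 0}

/-- A Hilbert C*-submodule: a norm-closed subset which is closed under addition and under
the actions of `ℂ` and `A`. -/
structure IsHilbertSubmodule (N : Set M) : Prop where
  isClosed : IsClosed N
  zero_mem : (0 : M) ∈ N
  add_mem : ∀ ⦃x y : M⦄, x ∈ N → y ∈ N → x + y ∈ N
  smulC_mem : ∀ (c : ℂ) ⦃x : M⦄, x ∈ N → c • x ∈ N
  smulA_mem : ∀ (a : A) ⦃x : M⦄, x ∈ N → a • x ∈ N

end Defs

section Maps

variable (A : Type u) [NonUnitalCStarAlgebra A] {M : Type v} {M₂ : Type w}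
  [NormedAddCommGroup M] [NormedSpace ℂ M] [SMul A M]
  [NormedAddCommGroup M₂] [NormedSpace ℂ M₂] [SMul A M₂]

/-- A bounded `A`-linear map between (left) normed `A`-modules. -/
structure IsBoundedModuleMap (T : M → M₂) : Prop where
  map_add : ∀ x y : M, T (x + y) = T x + T y
  map_smulC : ∀ (c : ℂ) (x : M), T (c • x) = c • T x
  map_smulA : ∀ (a : A) (x : M), T (a • x) = a • T x
  bound : ∃ C : ℝ, ∀ x : M, ‖T x‖ ≤ C * ‖x‖

/-- The operator norm of a map between normed modules. -/
def opNorm (T : M → M₂) : ℝ :=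
  sInf {c : ℝ | 0 ≤ c ∧ ∀ x : M, ‖T x‖ ≤ c * ‖x‖}

end Maps

section Dual

variable (A : Type u) [NonUnitalCStarAlgebra A] {M : Type v}
  [NormedAddCommGroup M] [NormedSpace ℂ M] [SMul A M]

/-- A bounded `A`-linear map `M → A`, i.e. an element of the `A`-dual `M'`. -/
structure IsDualVector (r : M → A) : Prop where
  map_add : ∀ x y : M, r (x + y) = r x + r y
  map_smulC : ∀ (c : ℂ) (x : M), r (c • x) = c • r x
  map_smulA : ∀ (a : A) (x : M), r (a • x) = a * r x
  bound : ∃ C : ℝ, ∀ x : M, ‖r x‖ ≤ C * ‖x‖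

/-- The norm of an element of the `A`-dual. -/
def dualNorm (r : M → A) : ℝ :=
  sInf {c : ℝ | 0 ≤ c ∧ ∀ x : M, ‖r x‖ ≤ c * ‖x‖}

/-- A function `r : M → A` which restricts to a bounded `A`-linear map on the subset `S`;
this represents an element of the `A`-dual `S'` of the submodule `S` (only the values on `S`
are relevant). -/
structure IsDualVectorOn (S : Set M) (r : M → A) : Prop where
  map_add : ∀ x ∈ S, ∀ y ∈ S, r (x + y) = r x + r y
  map_smulC : ∀ (c : ℂ), ∀ x ∈ S, r (c • x) = c • r x
  map_smulA : ∀ (a : A), ∀ x ∈ S, r (a • x) = a * r x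
  bound : ∃ C : ℝ, ∀ x ∈ S, ‖r x‖ ≤ C * ‖x‖

/-- The norm of a bounded `A`-linear map given on the subset `S`. -/
def dualNormOn (S : Set M) (r : M → A) : ℝ :=
  sInf {c : ℝ | 0 ≤ c ∧ ∀ x ∈ S, ‖r x‖ ≤ c * ‖x‖}

/-- The canonical embedding of `M` into its `A`-dual: `x ↦ ⟨·, x⟩`. -/
def toDualFun [HilbertCStarModule A M] (x : M) : M → A := fun y => hInner A y x

/-- The canonical evaluation map of `M` into its `A`-bidual: `Ω x : r ↦ r x`. -/
def omegaFun (x : M) : (M → A) → A := fun r => r x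

/-- A bounded `A`-linear functional on the `A`-dual `M'`, i.e. an element of the
`A`-bidual `M''`.  Here `M'` carries the `A`-action `(a • r) x = r x * (star a)`, and the
corresponding `A`-linearity for functionals on `M'` reads `F (a • r) = F r * star a`
(which holds for all evaluation functionals `Ω x`). -/
structure IsBidualVector (F : (M → A) → A) : Prop where
  map_add : ∀ r s : M → A, IsDualVector A r → IsDualVector A s →
    F (fun x => r x + s x) = F r + F s
  map_smulC : ∀ (c : ℂ) (r : M → A), IsDualVector A r →
    F (fun x => c • r x) = c • F r
  map_smulA : ∀ (a : A) (r : M → A), IsDualVector A r →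
    F (fun x => r x * star a) = F r * star a
  bound : ∃ C : ℝ, ∀ r : M → A, IsDualVector A r → ‖F r‖ ≤ C * dualNorm A r

/-- The norm of an element of the `A`-bidual. -/
def bidualNorm (F : (M → A) → A) : ℝ :=
  sInf {c : ℝ | 0 ≤ c ∧ ∀ r : M → A, IsDualVector A r → ‖F r‖ ≤ c * dualNorm A r}

/-- An element of the `A`-bidual `S''` of a submodule `S ⊆ M`, represented as a functional
on (representatives of) elements of the `A`-dual `S'`. -/
structure IsBidualVectorOn (S : Set M) (F : (M → A) → A) : Prop where
  congr : ∀ r s : M → A, IsDualVectorOn A S r → IsDualVectorOn A S s →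
    (∀ x ∈ S, r x = s x) → F r = F s
  map_add : ∀ r s : M → A, IsDualVectorOn A S r → IsDualVectorOn A S s →
    F (fun x => r x + s x) = F r + F s
  map_smulC : ∀ (c : ℂ) (r : M → A), IsDualVectorOn A S r →
    F (fun x => c • r x) = c • F r
  map_smulA : ∀ (a : A) (r : M → A), IsDualVectorOn A S r →
    F (fun x => r x * star a) = F r * star a
  bound : ∃ C : ℝ, ∀ r : M → A, IsDualVectorOn A S r → ‖F r‖ ≤ C * dualNormOn A S r

/-- The norm of an element of the `A`-bidual of a submodule `S`. -/
def bidualNormOn (S : Set M) (F : (M → A) → A) : ℝ :=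
  sInf {c : ℝ | 0 ≤ c ∧ ∀ r : M → A, IsDualVectorOn A S r → ‖F r‖ ≤ c * dualNormOn A S r}

/-- `M` is `A`-reflexive if the canonical map `Ω : M → M''` is surjective. -/
def IsCReflexive [HilbertCStarModule A M] : Prop :=
  ∀ F : (M → A) → A, IsBidualVector A F →
    ∃ x : M, ∀ r : M → A, IsDualVector A r → F r = r x

end Dual

section Order

/-- The C*-order relation: `x ≤ y` iff `y - x` is positive, i.e. of the form `c* c`. -/
def cstarLE {B : Type*} [NonUnitalRing B] [Star B] (x y : B) : Prop :=
  ∃ c : B, y - x = star c * c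

/-- `m` is the least upper bound of `S` with respect to the C*-order. -/
def IsCStarLUB {B : Type*} [NonUnitalRing B] [Star B] (S : Set B) (m : B) : Prop :=
  (∀ b ∈ S, cstarLE b m) ∧ ∀ u : B, (∀ b ∈ S, cstarLE b u) → cstarLE m u

/-- A C*-algebra is monotone complete if every norm-bounded increasingly directed set of
self-adjoint elements has a least upper bound. -/
def MonotoneComplete (B : Type*) [NonUnitalNormedRing B] [StarRing B] : Prop :=
  ∀ S : Set B, S.Nonempty → (∀ b ∈ S, star b = b) →
    (∀ x ∈ S, ∀ y ∈ S, ∃ z ∈ S, cstarLE x z ∧ cstarLE y z) →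
    (∃ C : ℝ, ∀ b ∈ S, ‖b‖ ≤ C) →
    ∃ m : B, IsCStarLUB S m

/-- A C*-algebra is additively complete if every family of positive elements whose finite
partial sums are norm-bounded has a least upper bound (of the set of its finite partial
sums). -/
def AdditivelyComplete (B : Type w) [NonUnitalNormedRing B] [StarRing B] : Prop :=
  ∀ (ι : Type w) (f : ι → B), (∀ i, ∃ c : B, f i = star c * c) →
    (∃ C : ℝ, ∀ s : Finset ι, ‖∑ i ∈ s, f i‖ ≤ C) →
    ∃ m : B, IsCStarLUB {b : B | ∃ s : Finset ι, b = ∑ i ∈ s, f i} m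

end Order

/-- The Hahn-Banach type extension property of a C*-algebra `A`: for every Hilbert
`A`-module `M` and every Hilbert `A`-submodule `N ⊆ M`, every bounded `A`-linear map
`r : N → A` extends to a bounded `A`-linear map `r' : M → A` with the same norm, with
`r'` restricted to `N` equal to `r` and `r'` vanishing on `N^⊥`. -/
def ExtensionProperty (A : Type u) [NonUnitalCStarAlgebra A] : Prop :=
  ∀ (M : Type v) [NormedAddCommGroup M] [NormedSpace ℂ M] [SMul A M]
    [HilbertCStarModule A M] (N : Set M), IsHilbertSubmodule A N →
    ∀ r : M → A, IsDualVectorOn A N r →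
      ∃ r' : M → A, IsDualVector A r' ∧ dualNorm A r' = dualNormOn A N r ∧
        (∀ x ∈ N, r' x = r x) ∧ (∀ x ∈ orthComp A N, r' x = 0)

section BidualInner

variable (A : Type u) [NonUnitalCStarAlgebra A] {M : Type v}
  [NormedAddCommGroup M] [NormedSpace ℂ M] [SMul A M]

/-- The canonical image `Ω(N)` of a subset `N ⊆ M` in the `A`-bidual `M''`. -/
def omegaImage (N : Set M) : Set ((M → A) → A) := {F | ∃ n ∈ N, F = omegaFun A n}

/-- Paschke's extension of the `A`-valued inner product of the Hilbert `A`-module `M` to its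
`A`-bidual `M''` (whose elements `F` carry the `A`-action `(a • F) r = a * F r`), making
`M''` a Hilbert `A`-module such that `Ω` is inner-product preserving and
`⟨Ω x, F⟩ = F(⟨·,x⟩)*`. -/
structure IsBidualInnerExtension [HilbertCStarModule A M]
    (ip : ((M → A) → A) → ((M → A) → A) → A) : Prop where
  congr_left : ∀ F F' G : (M → A) → A, IsBidualVector A F → IsBidualVector A F' →
    IsBidualVector A G → (∀ r : M → A, IsDualVector A r → F r = F' r) → ip F G = ip F' G
  map_add_left : ∀ F G H : (M → A) → A, IsBidualVector A F → IsBidualVector A G →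
    IsBidualVector A H → ip (fun r => F r + G r) H = ip F H + ip G H
  map_smulA_left : ∀ (a : A) (F G : (M → A) → A), IsBidualVector A F → IsBidualVector A G →
    ip (fun r => a * F r) G = a * ip F G
  map_smulC_left : ∀ (c : ℂ) (F G : (M → A) → A), IsBidualVector A F → IsBidualVector A G →
    ip (fun r => c • F r) G = c • ip F G
  conj_symm : ∀ F G : (M → A) → A, IsBidualVector A F → IsBidualVector A G →
    ip F G = star (ip G F)
  self_pos : ∀ F : (M → A) → A, IsBidualVector A F → ∃ b : A, ip F F = star b * b
  norm_compat : ∀ F : (M → A) → A, IsBidualVector A F →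
    bidualNorm A F = Real.sqrt ‖ip F F‖
  omega_compat : ∀ (x : M) (F : (M → A) → A), IsBidualVector A F →
    ip (omegaFun A x) F = star (F (toDualFun A x))

/-- The orthogonal complement of a subset of the `A`-bidual `M''` with respect to the
extended inner product `ip`. -/
def bidualOrthComp (ip : ((M → A) → A) → ((M → A) → A) → A)
    (S : Set ((M → A) → A)) : Set ((M → A) → A) :=
  {F | IsBidualVector A F ∧ ∀ G ∈ S, ip F G = 0}

end BidualInner

section OrderLimits

variable {D : Type*}

variable {B : Type*} [CStarAlgebra B] [PartialOrder B]

section Graph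

variable [Preorder D]

variable (D B) in
/-- The graph of the order limit: the span of all pairs consisting of an increasing net of
self-adjoint elements and its least upper bound. -/
def orderLimits : Submodule ℂ ((D → B) × B) :=
  Submodule.span ℂ {z | Monotone z.1 ∧ (∀ d, IsSelfAdjoint (z.1 d)) ∧ IsLUB (Set.range z.1) z.2}

theorem mem_orderLimits_of_isLUB {p : D → B} {P : B} (hp : Monotone p)
    (hs : ∀ d, IsSelfAdjoint (p d)) (hP : IsLUB (Set.range p) P) : (p, P) ∈ orderLimits D B :=
  Submodule.subset_span ⟨hp, hs, hP⟩

theorem const_mem_orderLimits [Nonempty D] (b : B) : (fun _ => b, b) ∈ orderLimits D B := by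
  have h : ∀ s : B, IsSelfAdjoint s → ((fun _ => s, s) : (D → B) × B) ∈ orderLimits D B :=
    fun s hs => mem_orderLimits_of_isLUB monotone_const (fun _ => hs)
      (by rw [Set.range_const]; exact isLUB_singleton)
  have h' := add_mem (h _ (realPart b).2)
    ((orderLimits D B).smul_mem Complex.I (h _ (imaginaryPart b).2))
  convert h' using 1
  ext <;> simp [realPart_add_I_smul_imaginaryPart]

end Graph

/-- Two monotone families over a directed set may be added under least upper bounds. -/
theorem isLUB_range_add_of_monotone [Preorder D] [IsDirectedOrder D] {E : Type*}
    [AddCommGroup E] [PartialOrder E] [IsOrderedAddMonoid E] {p q : D → E} {P Q : E}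
    (hp : Monotone p) (hq : Monotone q) (hP : IsLUB (Set.range p) P)
    (hQ : IsLUB (Set.range q) Q) : IsLUB (Set.range (p + q)) (P + Q) := by
  constructor
  · rintro _ ⟨d, rfl⟩
    exact add_le_add (hP.1 ⟨d, rfl⟩) (hQ.1 ⟨d, rfl⟩)
  · intro u hu
    have h1 : ∀ d e, p d + q e ≤ u := fun d e => by
      obtain ⟨f, hdf, hef⟩ := exists_ge_ge d e
      exact (add_le_add (hp hdf) (hq hef)).trans (hu ⟨f, rfl⟩)
    have h2 : ∀ e, P ≤ u - q e := fun e => hP.2 (by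
      rintro _ ⟨d, rfl⟩
      exact le_sub_iff_add_le.2 (h1 d e))
    have h3 : Q ≤ u - P := hQ.2 (by
      rintro _ ⟨e, rfl⟩
      exact le_sub_comm.1 (h2 e))
    exact add_comm P Q ▸ le_sub_iff_add_le.1 h3

variable [StarOrderedRing B]

theorem isLUB_range_smul_of_nonneg {p : D → B} {P : B} (hP : IsLUB (Set.range p) P)
    {t : ℝ} (ht : 0 ≤ t) [Nonempty D] : IsLUB (Set.range fun d => t • p d) (t • P) := by
  rcases ht.eq_or_lt with rfl | ht
  · simp only [zero_smul, Set.range_const]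
    exact isLUB_singleton
  · constructor
    · rintro _ ⟨d, rfl⟩
      exact smul_le_smul_of_nonneg_left (hP.1 ⟨d, rfl⟩) ht.le
    · intro u hu
      have : P ≤ t⁻¹ • u := hP.2 (by
        rintro _ ⟨d, rfl⟩
        have := smul_le_smul_of_nonneg_left (hu ⟨d, rfl⟩) (inv_nonneg.2 ht.le)
        simpa [smul_smul, inv_mul_cancel₀ ht.ne'] using this)
      have := smul_le_smul_of_nonneg_left this ht.le
      simpa [smul_smul, mul_inv_cancel₀ ht.ne'] using this

theorem isLUB_range_conjugate_of_isUnit {p : D → B} {P : B} (hP : IsLUB (Set.range p) P)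
    {c : B} (hc : IsUnit c) : IsLUB (Set.range fun d => star c * p d * c) (star c * P * c) := by
  constructor
  · rintro _ ⟨d, rfl⟩
    exact star_left_conjugate_le_conjugate (hP.1 ⟨d, rfl⟩) c
  · intro u hu
    have key : ∀ x : B, star c * x * c ≤ u ↔ x ≤ star (↑hc.unit⁻¹ : B) * u * ↑hc.unit⁻¹ := by
      intro x
      have h1 : c * (↑hc.unit⁻¹ : B) = 1 := hc.mul_val_inv
      have h2 : (↑hc.unit⁻¹ : B) * c = 1 := hc.val_inv_mul
      have h3 : star (↑hc.unit⁻¹ : B) * star c = 1 := by rw [← star_mul, h1, star_one]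
      have h4 : star c * star (↑hc.unit⁻¹ : B) = 1 := by rw [← star_mul, h2, star_one]
      constructor <;> intro h
      · have := star_left_conjugate_le_conjugate h (↑hc.unit⁻¹ : B)
        rwa [show star (↑hc.unit⁻¹ : B) * (star c * x * c) * ↑hc.unit⁻¹
          = (star (↑hc.unit⁻¹ : B) * star c) * x * (c * ↑hc.unit⁻¹) by noncomm_ring,
          h1, h3, one_mul, mul_one] at this
      · have := star_left_conjugate_le_conjugate h c
        rwa [show star c * (star (↑hc.unit⁻¹ : B) * u * ↑hc.unit⁻¹) * c
          = (star c * star (↑hc.unit⁻¹ : B)) * u * (↑hc.unit⁻¹ * c) by noncomm_ring,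
          h2, h4, one_mul, mul_one] at this
    rw [key]
    refine hP.2 ?_
    rintro _ ⟨d, rfl⟩
    exact (key _).1 (hu ⟨d, rfl⟩)

theorem monotone_conjugate [Preorder D] {p : D → B} (hp : Monotone p) (c : B) :
    Monotone fun d => star c * p d * c :=
  fun _ _ h => star_left_conjugate_le_conjugate (hp h) c

theorem isLUB_range_conjugate [Preorder D] [IsDirectedOrder D] {p : D → B} {P : B} (hp : Monotone p)
    (hP : IsLUB (Set.range p) P) (c : B) :
    IsLUB (Set.range fun d => star c * p d * c) (star c * P * c) := by
  constructor
  · rintro _ ⟨d, rfl⟩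
    exact star_left_conjugate_le_conjugate (hP.1 ⟨d, rfl⟩) c
  intro u hu
  obtain ⟨t, ht, hu1, hu2⟩ : ∃ t : ℝ, 0 ≤ t ∧ IsUnit (c + algebraMap ℝ B t) ∧
      IsUnit (c - algebraMap ℝ B t) := by
    refine ⟨‖c‖ * ‖(1 : B)‖ + 1, by positivity, ?_, ?_⟩
    · have h : -(‖c‖ * ‖(1 : B)‖ + 1) ∈ resolventSet ℝ c := by
        apply spectrum.mem_resolventSet_of_norm_lt_mul
        rw [norm_neg, Real.norm_of_nonneg (by positivity)]
        linarith
      have := (spectrum.mem_resolventSet_iff.1 h).neg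
      rwa [map_neg, neg_sub, sub_neg_eq_add] at this
    · have h : (‖c‖ * ‖(1 : B)‖ + 1) ∈ resolventSet ℝ c := by
        apply spectrum.mem_resolventSet_of_norm_lt_mul
        rw [Real.norm_of_nonneg (by positivity)]
        linarith
      have := (spectrum.mem_resolventSet_iff.1 h).neg
      rwa [neg_sub] at this
  have key : ∀ x : B, star (c + algebraMap ℝ B t) * x * (c + algebraMap ℝ B t) +
      star (c - algebraMap ℝ B t) * x * (c - algebraMap ℝ B t)
      = (2 : ℝ) • (star c * x * c) + (2 * t * t) • x := by
    intro x
    simp only [Algebra.algebraMap_eq_smul_one, star_add, star_sub, star_smul, star_one,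
      star_trivial, add_mul, mul_add, sub_mul, mul_sub, smul_mul_assoc, one_mul, mul_smul_comm,
      mul_one, smul_add, smul_smul]
    module
  have h := isLUB_range_add_of_monotone (monotone_conjugate hp (c + algebraMap ℝ B t))
    (monotone_conjugate hp (c - algebraMap ℝ B t)) (isLUB_range_conjugate_of_isUnit hP hu1)
    (isLUB_range_conjugate_of_isUnit hP hu2)
  rw [key] at h
  have h' : (2 : ℝ) • (star c * P * c) + (2 * t * t) • P ≤ (2 : ℝ) • u + (2 * t * t) • P := by
    refine h.2 ?_
    rintro _ ⟨d, rfl⟩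
    simp only [Pi.add_apply, key]
    exact add_le_add (smul_le_smul_of_nonneg_left (hu ⟨d, rfl⟩) zero_le_two)
      (smul_le_smul_of_nonneg_left (hP.1 ⟨d, rfl⟩) (by positivity))
  have h2 := smul_le_smul_of_nonneg_left (le_of_add_le_add_right h')
    (inv_nonneg.2 (zero_le_two (α := ℝ)))
  simpa [smul_smul] using h2

variable [Preorder D] [IsDirectedOrder D]

theorem mul_right_mem_orderLimits {x : D → B} {b : B} (h : (x, b) ∈ orderLimits D B) (c : B) :
    (fun d => x d * c, b * c) ∈ orderLimits D B := by
  suffices H : ∀ z ∈ orderLimits D B, (fun d => z.1 d * c, z.2 * c) ∈ orderLimits D B from H _ h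
  intro z hz
  induction hz using Submodule.span_induction with
  | mem z hz =>
    obtain ⟨hm, hs, hl⟩ := hz
    have hk : ∀ a : B, (fun d => star a * z.1 d * a, star a * z.2 * a) ∈ orderLimits D B :=
      fun a => mem_orderLimits_of_isLUB (monotone_conjugate hm a)
        (fun d => (hs d).conjugate' a) (isLUB_range_conjugate hm hl a)
    have key : ∀ y : B, y * c = (1 / 4 : ℂ) • (star (c + 1) * y * (c + 1)) -
        (1 / 4 : ℂ) • (star (c - 1) * y * (c - 1)) +
        (Complex.I / 4) • (star (c + Complex.I • 1) * y * (c + Complex.I • 1)) -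
        (Complex.I / 4) • (star (c - Complex.I • 1) * y * (c - Complex.I • 1)) := by
      intro y
      simp only [star_add, star_sub, star_smul, star_one, add_mul, mul_add, sub_mul, mul_sub,
        smul_mul_assoc, one_mul, mul_smul_comm, mul_one, smul_add, smul_sub, smul_smul,
        RCLike.star_def, Complex.conj_I]
      match_scalars <;> ring_nf <;> simp <;> ring
    have h4 := sub_mem (add_mem (sub_mem
      ((orderLimits D B).smul_mem (1 / 4 : ℂ) (hk (c + 1)))
      ((orderLimits D B).smul_mem (1 / 4 : ℂ) (hk (c - 1))))
      ((orderLimits D B).smul_mem (Complex.I / 4) (hk (c + Complex.I • 1))))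
      ((orderLimits D B).smul_mem (Complex.I / 4) (hk (c - Complex.I • 1)))
    convert h4 using 1
    refine Prod.ext (funext fun d => ?_) ?_
    · exact key _
    · exact key _
  | zero =>
    convert (orderLimits D B).zero_mem using 1
    refine Prod.ext (funext fun d => ?_) ?_ <;> simp
  | add z z' _ _ h h' =>
    convert add_mem h h' using 1
    refine Prod.ext (funext fun d => ?_) ?_ <;> simp [add_mul]
  | smul t z _ h =>
    convert (orderLimits D B).smul_mem t h using 1
    refine Prod.ext (funext fun d => ?_) ?_ <;> simp

variable [Nonempty D]

theorem exists_monotone_of_mem_orderLimits {x : D → B} {b : B} (h : (x, b) ∈ orderLimits D B) :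
    ∃ (p q : D → B) (P Q : B), Monotone p ∧ Monotone q ∧ IsLUB (Set.range p) P ∧
      IsLUB (Set.range q) Q ∧ (∀ d, x d + star (x d) = p d - q d) ∧ b + star b = P - Q := by
  suffices H : ∀ z ∈ orderLimits D B, ∀ t : ℂ, ∃ (p q : D → B) (P Q : B), Monotone p ∧
      Monotone q ∧ IsLUB (Set.range p) P ∧ IsLUB (Set.range q) Q ∧
      (∀ d, t • z.1 d + star (t • z.1 d) = p d - q d) ∧ t • z.2 + star (t • z.2) = P - Q by
    simpa using H _ h 1
  intro z hz
  have hzero : IsLUB (Set.range fun _ : D => (0 : B)) 0 := by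
    rw [Set.range_const]; exact isLUB_singleton
  induction hz using Submodule.span_induction with
  | mem z hz =>
    intro t
    obtain ⟨hm, hs, hl⟩ := hz
    have hsl : IsSelfAdjoint z.2 := by
      obtain ⟨d⟩ := ‹Nonempty D›
      have := (IsSelfAdjoint.of_nonneg (sub_nonneg.2 (hl.1 ⟨d, rfl⟩))).add (hs d)
      simpa using this
    have key : ∀ y : B, IsSelfAdjoint y → t • y + star (t • y) = (2 * t.re) • y := by
      intro y hy
      rw [star_smul, hy.star_eq, ← add_smul, RCLike.star_def, Complex.add_conj]
      norm_cast
    rcases le_total 0 t.re with ht | ht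
    · refine ⟨fun d => (2 * t.re) • z.1 d, fun _ => 0, (2 * t.re) • z.2, 0, ?_, monotone_const,
        isLUB_range_smul_of_nonneg hl (by positivity), hzero, ?_, ?_⟩
      · exact fun _ _ h => smul_le_smul_of_nonneg_left (hm h) (by positivity)
      · exact fun d => by rw [key _ (hs d), sub_zero]
      · rw [key _ hsl, sub_zero]
    · have ht' : 0 ≤ -(2 * t.re) := by linarith
      refine ⟨fun _ => 0, fun d => (-(2 * t.re)) • z.1 d, 0, (-(2 * t.re)) • z.2,
        monotone_const, ?_, hzero, isLUB_range_smul_of_nonneg hl ht', ?_, ?_⟩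
      · exact fun _ _ h => smul_le_smul_of_nonneg_left (hm h) ht'
      · exact fun d => by simp only [key _ (hs d), neg_smul, sub_neg_eq_add, zero_add]
      · rw [key _ hsl, neg_smul, sub_neg_eq_add, zero_add]
  | zero =>
    exact fun t => ⟨fun _ => 0, fun _ => 0, 0, 0, monotone_const, monotone_const, hzero, hzero,
      by simp, by simp⟩
  | add z z' _ _ h h' =>
    intro t
    obtain ⟨p, q, P, Q, hp, hq, hP, hQ, h1, h2⟩ := h t
    obtain ⟨p', q', P', Q', hp', hq', hP', hQ', h1', h2'⟩ := h' t
    refine ⟨p + p', q + q', P + P', Q + Q', hp.add hp', hq.add hq',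
      isLUB_range_add_of_monotone hp hp' hP hP', isLUB_range_add_of_monotone hq hq' hQ hQ',
      fun d => ?_, ?_⟩
    · simp only [Prod.fst_add, Pi.add_apply, smul_add, star_add]
      rw [add_sub_add_comm, ← h1, ← h1']
      abel
    · simp only [Prod.snd_add, smul_add, star_add]
      rw [add_sub_add_comm, ← h2, ← h2']
      abel
  | smul s z _ h =>
    intro t
    simpa [smul_smul] using h (t * s)

/-- Order limits respect the order on real parts. -/
theorem add_star_nonneg_of_mem_orderLimits {x : D → B} {b : B} (h : (x, b) ∈ orderLimits D B)
    (d₀ : D) (hx : ∀ d, d₀ ≤ d → 0 ≤ x d + star (x d)) : 0 ≤ b + star b := by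
  obtain ⟨p, q, P, Q, hp, hq, hP, hQ, h1, h2⟩ := exists_monotone_of_mem_orderLimits h
  rw [h2, sub_nonneg]
  refine hQ.2 ?_
  rintro _ ⟨d, rfl⟩
  obtain ⟨e, hde, hde'⟩ := exists_ge_ge d d₀
  have h3 := hx e hde'
  rw [h1, sub_nonneg] at h3
  exact (hq hde).trans (h3.trans (hP.1 ⟨e, rfl⟩))

/-- A bound on the absolute values of a net passes to its order limit. -/
theorem mul_star_le_of_mem_orderLimits {x : D → B} {b c : B} (h : (x, b) ∈ orderLimits D B)
    (d₀ : D) (hx : ∀ d, d₀ ≤ d → x d * star (x d) ≤ c) : b * star b ≤ c := by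
  have hc : IsSelfAdjoint c := .of_nonneg ((mul_star_self_nonneg _).trans (hx d₀ le_rfl))
  have h1 := sub_mem (const_mem_orderLimits (D := D) (c + b * star b))
    ((orderLimits D B).smul_mem 2 (mul_right_mem_orderLimits h (star b)))
  have h2 := add_star_nonneg_of_mem_orderLimits (x := fun d => (c + b * star b) -
    (2 : ℂ) • (x d * star b)) h1 d₀ (fun d hd => by
      have e : (c + b * star b) - (2 : ℂ) • (x d * star b) +
          star ((c + b * star b) - (2 : ℂ) • (x d * star b)) =
          (2 : ℝ) • ((c - x d * star (x d)) + (x d - b) * star (x d - b)) := by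
        simp only [star_sub, star_add, star_mul, star_star, hc.star_eq, sub_mul, mul_sub,
          two_smul]
        abel
      rw [e]
      exact smul_nonneg zero_le_two (add_nonneg (sub_nonneg.2 (hx d hd))
        (mul_star_self_nonneg _)))
  have e : (c + b * star b) - (2 : ℂ) • (b * star b) +
      star ((c + b * star b) - (2 : ℂ) • (b * star b)) = (2 : ℝ) • (c - b * star b) := by
    simp only [star_sub, star_add, star_mul, star_star, hc.star_eq, two_smul]
    abel
  have h3 : 0 ≤ (2 : ℝ) • (c - b * star b) := by rw [← e]; exact h2
  have h4 := smul_nonneg (inv_nonneg.2 (zero_le_two (α := ℝ))) h3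
  rw [smul_smul, inv_mul_cancel₀ two_ne_zero, one_smul] at h4
  exact sub_nonneg.1 h4

theorem orderLimits_unique {x : D → B} {b b' : B} (h : (x, b) ∈ orderLimits D B)
    (h' : (x, b') ∈ orderLimits D B) : b = b' := by
  have h0 : ((fun _ => 0, b - b') : (D → B) × B) ∈ orderLimits D B := by
    convert sub_mem h h' using 1
    simp only [Prod.mk_sub_mk, sub_self]
    rfl
  have := mul_star_le_of_mem_orderLimits h0 (Classical.arbitrary D) (c := 0) (by simp)
  have := le_antisymm this (mul_star_self_nonneg _)
  rwa [CStarRing.mul_star_self_eq_zero_iff, sub_eq_zero] at this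

/-- Order limits extend norm limits. -/
theorem orderLimits_eq_of_norm_sub_le {x : D → B} {b c : B} (h : (x, b) ∈ orderLimits D B)
    (hx : ∀ ε > 0, ∃ d₀, ∀ d, d₀ ≤ d → ‖x d - c‖ ≤ ε) : b = c := by
  rw [← sub_eq_zero, ← norm_le_zero_iff]
  refine le_of_forall_pos_le_add fun ε hε => ?_
  rw [zero_add]
  obtain ⟨d₀, hd⟩ := hx ε hε
  have h0 : ((fun d => x d - c, b - c) : (D → B) × B) ∈ orderLimits D B :=
    sub_mem h (const_mem_orderLimits c)
  have h1 := mul_star_le_of_mem_orderLimits h0 d₀ (c := algebraMap ℝ B (ε ^ 2))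
    (fun d hd' => (CStarAlgebra.mul_star_le_algebraMap_norm_sq).trans
      (algebraMap_mono B (by gcongr; exact hd d hd')))
  have h2 := CStarAlgebra.norm_le_norm_of_nonneg_of_le (mul_star_self_nonneg _) h1
  rw [CStarRing.norm_self_mul_star] at h2
  rcases subsingleton_or_nontrivial B with hB | hB
  · rw [Subsingleton.elim (b - c) 0, norm_zero]; exact hε.le
  · rw [norm_algebraMap', Real.norm_of_nonneg (by positivity), ← sq] at h2
    exact (sq_le_sq₀ (norm_nonneg _) hε.le).1 h2

end OrderLimits

section CStar

variable {A : Type*} [NonUnitalCStarAlgebra A] [PartialOrder A] [StarOrderedRing A]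

theorem exists_add_mul_eq_of_nonneg {p : A} (hp : 0 ≤ p) (c : A) : ∃ a, a + p * a = c := by
  have hs : ∀ x ∈ quasispectrum ℝ p, 1 + x ≠ 0 := fun x hx => by
    have := quasispectrum_nonneg_of_nonneg p hp x hx
    positivity
  have hf : ContinuousOn (fun x : ℝ => x * (1 + x)⁻¹) (quasispectrum ℝ p) :=
    continuousOn_id.mul ((continuousOn_const.add continuousOn_id).inv₀ hs)
  have hsa : IsSelfAdjoint p := .of_nonneg hp
  have hq : cfcₙ (fun x : ℝ => x * (1 + x)⁻¹) p + p * cfcₙ (fun x : ℝ => x * (1 + x)⁻¹) p = p := by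
    have h1 : cfcₙ (fun x : ℝ => x * (x * (1 + x)⁻¹)) p =
        p * cfcₙ (fun x : ℝ => x * (1 + x)⁻¹) p := by
      rw [cfcₙ_mul (fun x : ℝ => x) _ p continuousOn_id rfl hf (by simp), cfcₙ_id' ℝ p]
    have hf' : ContinuousOn (fun x : ℝ => x * (x * (1 + x)⁻¹)) (quasispectrum ℝ p) :=
      continuousOn_id.mul hf
    rw [← h1, ← cfcₙ_add _ _ p hf (by simp) hf' (by simp)]
    conv_rhs => rw [← cfcₙ_id' ℝ p]
    refine cfcₙ_congr fun x hx => ?_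
    have := hs x hx
    field_simp
  refine ⟨c - cfcₙ (fun x : ℝ => x * (1 + x)⁻¹) p * c, ?_⟩
  rw [mul_sub, ← mul_assoc]
  nth_rewrite 2 [← hq]
  noncomm_ring

theorem norm_conjugate_le_one_of_le {B : Type*} [CStarAlgebra B] [PartialOrder B]
    [StarOrderedRing B] {p s : B} (hp : 0 ≤ p) (hs : IsStrictlyPositive s) :
    p ≤ s ↔ ‖s ^ (-(1 / 2) : ℝ) * p * star (s ^ (-(1 / 2) : ℝ))‖ ≤ 1 := by
  have h1 : IsSelfAdjoint (s ^ (-(1 / 2) : ℝ)) := .of_nonneg CFC.rpow_nonneg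
  have h2 : IsSelfAdjoint (CFC.sqrt p) := .of_nonneg (CFC.sqrt_nonneg p)
  have h3 : s ^ (-(1 / 2) : ℝ) * p * star (s ^ (-(1 / 2) : ℝ)) =
      star (CFC.sqrt p * s ^ (-(1 / 2) : ℝ)) * (CFC.sqrt p * s ^ (-(1 / 2) : ℝ)) := by
    rw [star_mul, h1.star_eq, h2.star_eq, mul_assoc, mul_assoc, ← mul_assoc (CFC.sqrt p),
      CFC.sqrt_mul_sqrt_self p]
  rw [h3, CStarRing.norm_star_mul_self, le_iff_norm_sqrt_mul_rpow p s, ← sq,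
    sq_le_one_iff₀ (norm_nonneg _)]

open Filter Topology in
open scoped CStarAlgebra in
/-- The order of positive elements is determined by the norms of their compressions. -/
theorem le_of_forall_norm_conjugate_le {p d : A} (hp : 0 ≤ p) (hd : 0 ≤ d)
    (h : ∀ a : A, ‖a * p * star a‖ ≤ ‖a * d * star a‖) : p ≤ d := by
  have happ := CStarAlgebra.increasingApproximateUnit A
  have := happ.neBot
  have hlim : ∀ (b : Unitization ℂ A) (q : A), Tendsto
      (fun e : A => ‖b * ((e * q * star e : A) : Unitization ℂ A) * star b‖)
      (CStarAlgebra.approximateUnit A) (𝓝 ‖b * (q : Unitization ℂ A) * star b‖) := by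
    intro b q
    have h1 : Tendsto (fun e : A => e * q * star e) (CStarAlgebra.approximateUnit A) (𝓝 q) := by
      have h2 : Tendsto (fun e : A => e * q * e) (CStarAlgebra.approximateUnit A) (𝓝 q) := by
        rw [tendsto_iff_norm_sub_tendsto_zero]
        have h3 := (tendsto_iff_norm_sub_tendsto_zero.1 (happ.tendsto_mul_left q)).add
          (tendsto_iff_norm_sub_tendsto_zero.1 (happ.tendsto_mul_right q))
        rw [add_zero] at h3
        refine squeeze_zero' (.of_forall fun _ => norm_nonneg _) ?_ h3
        filter_upwards [happ.eventually_norm] with e he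
        calc ‖e * q * e - q‖ = ‖(e * q - q) * e + (q * e - q)‖ := by
              congr 1; noncomm_ring
          _ ≤ ‖e * q - q‖ * ‖e‖ + ‖q * e - q‖ :=
              (norm_add_le _ _).trans (by gcongr; exact norm_mul_le _ _)
          _ ≤ _ := by
              have := mul_le_of_le_one_right (norm_nonneg (e * q - q)) he
              linarith
      refine h2.congr' ?_
      filter_upwards [happ.eventually_star_eq] with e he
      rw [he]
    have hc : Continuous fun x : A => ‖b * (x : Unitization ℂ A) * star b‖ := by
      have := Unitization.continuous_inr (𝕜 := ℂ) (A := A)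
      fun_prop
    exact (hc.tendsto q).comp h1
  have hu : ∀ b : Unitization ℂ A, ‖b * (p : Unitization ℂ A) * star b‖ ≤
      ‖b * (d : Unitization ℂ A) * star b‖ := by
    intro b
    refine le_of_tendsto_of_tendsto' (hlim b p) (hlim b d) fun e => ?_
    obtain ⟨a, ha⟩ : ∃ a : A, (a : Unitization ℂ A) = b * (e : Unitization ℂ A) := by
      refine ⟨b.fst • e + b.snd * e, ?_⟩
      ext <;> simp
    have key : ∀ q : A, ‖b * ((e * q * star e : A) : Unitization ℂ A) * star b‖ =
        ‖a * q * star a‖ := by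
      intro q
      rw [← Unitization.norm_inr (𝕜 := ℂ) (a * q * star a)]
      simp only [Unitization.inr_mul, Unitization.inr_star, ha, star_mul, mul_assoc]
    rw [key, key]
    exact h a
  have hp' : (0 : Unitization ℂ A) ≤ p := Unitization.inr_nonneg_iff.2 hp
  have hd' : (0 : Unitization ℂ A) ≤ d := Unitization.inr_nonneg_iff.2 hd
  have heps : ∀ ε : ℝ, 0 < ε → (p : Unitization ℂ A) ≤ d + algebraMap ℝ _ ε := by
    intro ε hε
    have hs : IsStrictlyPositive ((d : Unitization ℂ A) + algebraMap ℝ _ ε) :=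
      .nonneg_add hd' (isStrictlyPositive_algebraMap hε)
    rw [norm_conjugate_le_one_of_le hp' hs]
    refine (hu _).trans ((norm_conjugate_le_one_of_le hd' hs).1 ?_)
    exact le_add_of_nonneg_right (algebraMap_nonneg _ hε.le)
  rw [← Unitization.inr_le_iff p d (.of_nonneg hp) (.of_nonneg hd)]
  have ht : Tendsto (fun ε : ℝ => (d : Unitization ℂ A) + algebraMap ℝ _ ε) (𝓝[>] 0)
      (𝓝 (d : Unitization ℂ A)) := by
    have hc : Continuous fun ε : ℝ => (d : Unitization ℂ A) + algebraMap ℝ _ ε :=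
      continuous_const.add (continuous_algebraMap ℝ _)
    simpa using (hc.tendsto 0).mono_left nhdsWithin_le_nhds
  exact ge_of_tendsto ht (eventually_mem_nhdsWithin.mono fun ε hε => heps ε hε)

end CStar

theorem dualNorm_le {A M : Type*} [NonUnitalCStarAlgebra A] [NormedAddCommGroup M] {r : M → A}
    {c : ℝ} (hc : 0 ≤ c) (h : ∀ x, ‖r x‖ ≤ c * ‖x‖) : dualNorm A r ≤ c :=
  csInf_le ⟨0, fun _ hd => hd.1⟩ ⟨hc, h⟩

section HilbertModule

variable {A : Type*} [NonUnitalCStarAlgebra A] {M : Type*} [NormedAddCommGroup M]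
  [NormedSpace ℂ M] [SMul A M]

namespace IsDualVector

variable {r : M → A} (hr : IsDualVector A r)
include hr

theorem map_sum {J : Type*} (X : Finset J) (x : J → M) : r (∑ i ∈ X, x i) = ∑ i ∈ X, r (x i) :=
  _root_.map_sum (AddMonoidHom.mk' r hr.map_add) x X

theorem dualNorm_mem : dualNorm A r ∈ {c : ℝ | 0 ≤ c ∧ ∀ x : M, ‖r x‖ ≤ c * ‖x‖} := by
  have h : {c : ℝ | 0 ≤ c ∧ ∀ x : M, ‖r x‖ ≤ c * ‖x‖} =
      Set.Ici 0 ∩ ⋂ x : M, {c : ℝ | ‖r x‖ ≤ c * ‖x‖} := by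
    ext; simp
  refine IsClosed.csInf_mem ?_ ?_ ⟨0, fun c hc => hc.1⟩
  · rw [h]
    exact isClosed_Ici.inter (isClosed_iInter fun x => isClosed_le continuous_const (by fun_prop))
  · obtain ⟨C, hC⟩ := hr.bound
    exact ⟨|C|, abs_nonneg C, fun x => (hC x).trans (by gcongr; exact le_abs_self C)⟩

theorem dualNorm_nonneg : 0 ≤ dualNorm A r := hr.dualNorm_mem.1

theorem norm_le (x : M) : ‖r x‖ ≤ dualNorm A r * ‖x‖ := hr.dualNorm_mem.2 x

end IsDualVector

theorem IsDualVector.add_smul {r s : M → A} (hr : IsDualVector A r) (hs : IsDualVector A s)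
    (c : ℂ) : IsDualVector A fun x => r x + c • s x where
  map_add x y := by rw [hr.map_add, hs.map_add, smul_add]; abel
  map_smulC d x := by rw [hr.map_smulC, hs.map_smulC, smul_add, smul_comm]
  map_smulA a x := by rw [hr.map_smulA, hs.map_smulA, mul_add, mul_smul_comm]
  bound := ⟨dualNorm A r + ‖c‖ * dualNorm A s, fun x => by
    calc ‖r x + c • s x‖ ≤ ‖r x‖ + ‖c‖ * ‖s x‖ := (norm_add_le _ _).trans_eq (by rw [norm_smul])
      _ ≤ dualNorm A r * ‖x‖ + ‖c‖ * (dualNorm A s * ‖x‖) := by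
        gcongr
        exacts [hr.norm_le x, hs.norm_le x]
      _ = _ := by ring⟩

theorem IsDualVector.mul_star {r : M → A} (hr : IsDualVector A r) (a : A) :
    IsDualVector A fun x => r x * star a where
  map_add x y := by rw [hr.map_add, add_mul]
  map_smulC d x := by rw [hr.map_smulC, smul_mul_assoc]
  map_smulA b x := by rw [hr.map_smulA, mul_assoc]
  bound := ⟨dualNorm A r * ‖star a‖, fun x => by
    calc ‖r x * star a‖ ≤ ‖r x‖ * ‖star a‖ := norm_mul_le _ _
      _ ≤ dualNorm A r * ‖x‖ * ‖star a‖ := by gcongr; exact hr.norm_le x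
      _ = _ := by ring⟩

variable [HilbertCStarModule A M]

theorem star_hInner (x y : M) : star (hInner A x y) = hInner A y x :=
  (HilbertCStarModule.inner_conj y x).symm

theorem hInner_add_left (x y z : M) : hInner A (x + y) z = hInner A x z + hInner A y z :=
  HilbertCStarModule.inner_add_left x y z

theorem hInner_smulC_left (c : ℂ) (x y : M) : hInner A (c • x) y = c • hInner A x y :=
  HilbertCStarModule.inner_smulC_left c x y

theorem hInner_smulA_left (a : A) (x y : M) : hInner A (a • x) y = a * hInner A x y :=
  HilbertCStarModule.inner_smulA_left a x y

theorem hInner_add_right (x y z : M) : hInner A x (y + z) = hInner A x y + hInner A x z := by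
  rw [← star_hInner, hInner_add_left, star_add, star_hInner, star_hInner]

theorem hInner_smulC_right (c : ℂ) (x y : M) : hInner A x (c • y) = star c • hInner A x y := by
  rw [← star_hInner, hInner_smulC_left, star_smul, star_hInner]

theorem hInner_smulA_right (a : A) (x y : M) : hInner A x (a • y) = hInner A x y * star a := by
  rw [← star_hInner, hInner_smulA_left, star_mul, star_hInner]

theorem hInner_sub_left (x y z : M) : hInner A (x - y) z = hInner A x z - hInner A y z := by
  rw [eq_sub_iff_add_eq, ← hInner_add_left, sub_add_cancel]

theorem hInner_sub_right (x y z : M) : hInner A x (y - z) = hInner A x y - hInner A x z := by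
  rw [eq_sub_iff_add_eq, ← hInner_add_right, sub_add_cancel]

variable (A) in
theorem norm_hInner_self (x : M) : ‖hInner A x x‖ = ‖x‖ ^ 2 := by
  rw [HilbertCStarModule.norm_eq (A := A) x, Real.sq_sqrt (norm_nonneg _), hInner]

section Order

variable [PartialOrder A] [StarOrderedRing A]

variable (A) in
theorem hInner_self_nonneg (x : M) : 0 ≤ hInner A x x := by
  obtain ⟨b, hb⟩ := HilbertCStarModule.inner_self_pos (A := A) x
  rw [hInner, hb]
  exact star_mul_self_nonneg b

/-- The Cauchy-Schwarz inequality. -/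
theorem norm_hInner_le (x y : M) : ‖hInner A x y‖ ≤ ‖x‖ * ‖y‖ := by
  rcases eq_or_ne y 0 with rfl | hy
  · rw [← zero_smul ℂ (0 : M), hInner_smulC_right]
    simp
  have ht : 0 < ‖hInner A y y‖ := by rw [norm_hInner_self]; positivity
  set a := hInner A x y with ha
  have h1 : ((2 * ‖hInner A y y‖) • (a * star a) : A) ≤
      ‖hInner A y y‖ • (a * star a) + (‖hInner A y y‖ * ‖hInner A y y‖) • hInner A x x := by
    have h2 := hInner_self_nonneg A (a • y - (‖hInner A y y‖ : ℂ) • x)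
    have h3 : a * hInner A y y * star a ≤ ‖hInner A y y‖ • (a * star a) :=
      CStarAlgebra.star_right_conjugate_le_norm_smul
        (.of_nonneg (hInner_self_nonneg A y))
    rw [hInner_sub_left, hInner_sub_right, hInner_sub_right, hInner_smulA_left, hInner_smulA_left,
      hInner_smulA_right, hInner_smulA_right, hInner_smulC_left, hInner_smulC_left,
      hInner_smulC_right, hInner_smulC_right, ← ha, ← star_hInner x y, ← ha, smul_smul] at h2
    simp only [RCLike.star_def, Complex.conj_ofReal, mul_smul_comm, ← Complex.ofReal_mul,
      Complex.coe_smul] at h2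
    rw [smul_mul_assoc, ← mul_assoc] at h2
    have h4 : ((2 * ‖hInner A y y‖) • (a * star a) : A) =
        ‖hInner A y y‖ • (a * star a) + ‖hInner A y y‖ • (a * star a) := by
      rw [two_mul, _root_.add_smul]
    rw [h4, ← sub_nonneg]
    refine h2.trans ?_
    rw [← sub_nonneg]
    have h5 := sub_nonneg.2 h3
    convert h5 using 1
    abel
  have h6 : ‖hInner A y y‖ • (a * star a) ≤
      (‖hInner A y y‖ * ‖hInner A y y‖) • hInner A x x := by
    rw [two_mul, _root_.add_smul] at h1
    exact le_of_add_le_add_left h1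
  have h7 := CStarAlgebra.norm_le_norm_of_nonneg_of_le
    (smul_nonneg ht.le (mul_star_self_nonneg a)) h6
  rw [norm_smul, norm_smul, CStarRing.norm_self_mul_star, norm_norm, norm_mul, norm_norm,
    mul_assoc, mul_le_mul_iff_right₀ ht, norm_hInner_self, norm_hInner_self] at h7
  have h8 : ‖a‖ ^ 2 ≤ (‖x‖ * ‖y‖) ^ 2 := by nlinarith
  exact (sq_le_sq₀ (norm_nonneg _) (by positivity)).1 h8

theorem isDualVector_toDualFun (x : M) : IsDualVector A (toDualFun A x) where
  map_add y z := hInner_add_left y z x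
  map_smulC c y := hInner_smulC_left c y x
  map_smulA a y := hInner_smulA_left a y x
  bound := ⟨‖x‖, fun y => (norm_hInner_le y x).trans_eq (mul_comm _ _)⟩

theorem dualNorm_toDualFun_le (x : M) : dualNorm A (toDualFun A x) ≤ ‖x‖ :=
  dualNorm_le (norm_nonneg x) fun y => (norm_hInner_le y x).trans_eq (mul_comm _ _)

/-- A bounded module map satisfies the operator Cauchy-Schwarz inequality. -/
theorem IsDualVector.mul_star_le {r : M → A} (hr : IsDualVector A r) (y : M) :
    r y * star (r y) ≤ (dualNorm A r ^ 2) • hInner A y y := by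
  refine le_of_forall_norm_conjugate_le (mul_star_self_nonneg _)
    (smul_nonneg (sq_nonneg _) (hInner_self_nonneg A y)) fun a => ?_
  have h1 : a * (r y * star (r y)) * star a = r (a • y) * star (r (a • y)) := by
    rw [hr.map_smulA, star_mul]
    noncomm_ring
  have h2 : a * (dualNorm A r ^ 2 • hInner A y y) * star a =
      dualNorm A r ^ 2 • hInner A (a • y) (a • y) := by
    rw [hInner_smulA_left, hInner_smulA_right, mul_smul_comm, smul_mul_assoc, mul_assoc]
  rw [h1, h2, CStarRing.norm_self_mul_star, norm_smul, norm_hInner_self, Real.norm_of_nonneg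
    (sq_nonneg _), ← sq, ← mul_pow]
  exact pow_le_pow_left₀ (norm_nonneg _) (hr.norm_le _) 2

end Order

end HilbertModule

section Resolvent

variable {A : Type*} [NonUnitalCStarAlgebra A] {M : Type*} [NormedAddCommGroup M]
  [NormedSpace ℂ M] [SMul A M] [HilbertCStarModule A M] {J : Type*}

/-- `n` solves `n + ∑ i ∈ X, ⟨v i, n⟩* • v i = ∑ i ∈ X, (g (v i))* • v i`; it is the regularized
representative of the functional `g` on the span of the `v i`, `i ∈ X`. -/
def IsResolvent (v : J → M) (X : Finset J) (g : M → A) (n : M) : Prop :=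
  n = ∑ i ∈ X, star (g (v i) - hInner A (v i) n) • v i

theorem IsResolvent.apply {v : J → M} {X : Finset J} {g h : M → A} {n : M}
    (hn : IsResolvent v X g n) (hh : IsDualVector A h) :
    h n = ∑ i ∈ X, star (g (v i) - hInner A (v i) n) * h (v i) := by
  conv_lhs => rw [hn]
  rw [hh.map_sum]
  exact Finset.sum_congr rfl fun i _ => hh.map_smulA _ _

theorem smul_sub' (a : A) (x y : M) : a • (x - y) = a • x - a • y := by
  rw [eq_sub_iff_add_eq, ← HilbertCStarModule.smul_add', sub_add_cancel]

theorem IsResolvent.add_smul {v : J → M} {X : Finset J} {g h : M → A} {n m : M}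
    (hn : IsResolvent v X g n) (hm : IsResolvent v X h m) (c : ℂ) :
    IsResolvent v X (fun x => g x + c • h x) (n + star c • m) := by
  have h1 : star c • m = ∑ i ∈ X, (star c • star (h (v i) - hInner A (v i) m)) • v i := by
    conv_lhs => rw [hm]
    rw [Finset.smul_sum]
    exact Finset.sum_congr rfl fun i _ => (HilbertCStarModule.smul_smul' _ _ _).symm
  rw [IsResolvent]
  nth_rewrite 1 [h1, hn]
  rw [← Finset.sum_add_distrib]
  refine Finset.sum_congr rfl fun i _ => ?_
  rw [← HilbertCStarModule.add_smul', hInner_add_right, hInner_smulC_right, star_star, ← star_smul,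
    ← star_add, smul_sub]
  congr 2
  abel

variable [PartialOrder A] [StarOrderedRing A]

theorem IsResolvent.apply_eq {v : J → M} {X : Finset J} {g h : M → A} {n : M}
    (hn : IsResolvent v X g n) (hh : IsDualVector A h) (m : M) :
    h n = ∑ i ∈ X, star (g (v i) - hInner A (v i) n) * (h (v i) - hInner A (v i) m) +
      hInner A n m := by
  have h1 := hn.apply (isDualVector_toDualFun (A := A) m)
  simp only [toDualFun] at h1
  rw [hn.apply hh, h1, ← Finset.sum_add_distrib]
  exact Finset.sum_congr rfl fun i _ => by rw [mul_sub, sub_add_cancel]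

theorem exists_isResolvent (v : J → M) (X : Finset J) (g : M → A) : ∃ n, IsResolvent v X g n := by
  classical
  induction X using Finset.induction_on generalizing g with
  | empty => exact ⟨0, by simp [IsResolvent]⟩
  | insert j X hj ih =>
    obtain ⟨n, hn⟩ := ih g
    obtain ⟨m, hm⟩ := ih (toDualFun A (v j))
    set y := v j - m with hy
    have hm' : m = ∑ i ∈ X, star (hInner A (v i) y) • v i := by
      conv_lhs => rw [hm]
      exact Finset.sum_congr rfl fun i _ => by rw [hy, hInner_sub_right]; rfl
    have hp : 0 ≤ hInner A (v j) y := by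
      have h1 : hInner A (v j) y = hInner A y y + ∑ i ∈ X,
          star (hInner A (v i) y) * hInner A (v i) y := by
        have h2 : hInner A m y = ∑ i ∈ X, star (hInner A (v i) y) * hInner A (v i) y := by
          have h3 := hm.apply (isDualVector_toDualFun (A := A) y)
          simp only [toDualFun, ← hInner_sub_right, ← hy] at h3
          exact h3
        rw [← h2, ← hInner_add_left, hy, sub_add_cancel]
      rw [h1]
      exact add_nonneg (hInner_self_nonneg A y)
        (Finset.sum_nonneg fun i _ => star_mul_self_nonneg _)
    obtain ⟨a, ha⟩ := exists_add_mul_eq_of_nonneg hp (g (v j) - hInner A (v j) n)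
    have hv : ∀ x, hInner A x (n + star a • y) = hInner A x n + hInner A x y * a := fun x => by
      rw [hInner_add_right, hInner_smulA_right, star_star]
    refine ⟨n + star a • y, ?_⟩
    have h1 : g (v j) - hInner A (v j) (n + star a • y) = a := by
      rw [hv, ← sub_sub, ← ha, add_sub_cancel_right]
    have h2 : ∑ i ∈ X, star (g (v i) - hInner A (v i) (n + star a • y)) • v i =
        n - star a • m := by
      conv_rhs => rw [hn]
      rw [eq_sub_iff_add_eq]
      have h3 : star a • m = ∑ i ∈ X, star a • star (hInner A (v i) y) • v i := by
        conv_lhs => rw [hm']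
        exact map_sum (AddMonoidHom.mk' (fun z : M => star a • z)
          (HilbertCStarModule.smul_add' (star a))) _ _
      rw [h3, ← Finset.sum_add_distrib]
      refine Finset.sum_congr rfl fun i _ => ?_
      rw [← HilbertCStarModule.mul_smul', ← HilbertCStarModule.add_smul', hv, ← star_mul,
        ← star_add, ← sub_sub, sub_add_cancel]
    rw [IsResolvent, Finset.sum_insert hj, h1, h2, hy, smul_sub']
    abel

section Positivity

variable {v : J → M} {X : Finset J} {g : M → A} {n : M} (hn : IsResolvent v X g n)
  (hg : IsDualVector A g)
include hn hg

theorem IsResolvent.hInner_self_le : hInner A n n ≤ g n := by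
  rw [hn.apply_eq hg n]
  exact le_add_of_nonneg_left (Finset.sum_nonneg fun i _ => star_mul_self_nonneg _)

theorem IsResolvent.apply_nonneg : 0 ≤ g n :=
  (hInner_self_nonneg A n).trans (hn.hInner_self_le hg)

theorem IsResolvent.norm_le : ‖n‖ ≤ dualNorm A g := by
  have h1 := CStarAlgebra.norm_le_norm_of_nonneg_of_le (hInner_self_nonneg A n)
    (hn.hInner_self_le hg)
  rw [norm_hInner_self] at h1
  have h2 := h1.trans (hg.norm_le n)
  rcases (norm_nonneg n).eq_or_lt with h0 | h0
  · rw [← h0]; exact hg.dualNorm_nonneg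
  · rw [sq] at h2
    exact le_of_mul_le_mul_right h2 h0

theorem IsResolvent.norm_apply_le : ‖g n‖ ≤ dualNorm A g ^ 2 := by
  rw [sq]
  exact (hg.norm_le n).trans (mul_le_mul_of_nonneg_left (hn.norm_le hg) hg.dualNorm_nonneg)

theorem IsResolvent.norm_sub_le {i : J} (hi : i ∈ X) :
    ‖g (v i) - hInner A (v i) n‖ ≤ dualNorm A g := by
  have h1 : star (g (v i) - hInner A (v i) n) * (g (v i) - hInner A (v i) n) ≤ g n := by
    rw [hn.apply_eq hg n]
    refine (Finset.single_le_sum (f := fun i => star (g (v i) - hInner A (v i) n) *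
      (g (v i) - hInner A (v i) n)) (fun i _ => star_mul_self_nonneg _) hi).trans ?_
    exact le_add_of_nonneg_right (hInner_self_nonneg A n)
  have h2 := (CStarAlgebra.norm_le_norm_of_nonneg_of_le (star_mul_self_nonneg _) h1).trans
    (hn.norm_apply_le hg)
  rw [CStarRing.norm_star_mul_self, ← sq] at h2
  exact (sq_le_sq₀ (norm_nonneg _) hg.dualNorm_nonneg).1 h2

/-- The regularized energy of a functional increases with the generating set. -/
theorem IsResolvent.apply_mono {Y : Finset J} {m : M} (hm : IsResolvent v Y g m) (hXY : X ⊆ Y) :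
    g n ≤ g m := by
  set α : J → A := fun i => g (v i) - hInner A (v i) n with hα
  set β : J → A := fun i => g (v i) - hInner A (v i) m with hβ
  have h1 : g n = ∑ i ∈ X, star (α i) * α i + hInner A n n := hn.apply_eq hg n
  have h2 : g n = ∑ i ∈ X, star (α i) * β i + hInner A n m := hn.apply_eq hg m
  have h3 : g m = ∑ i ∈ Y, star (β i) * β i + hInner A m m := hm.apply_eq hg m
  have h4 : g n = ∑ i ∈ X, star (β i) * α i + hInner A m n := by
    rw [← (IsSelfAdjoint.of_nonneg (hn.apply_nonneg hg)).star_eq, h2]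
    simp [star_hInner]
  have h5 : ∑ i ∈ X, star (β i) * β i ≤ ∑ i ∈ Y, star (β i) * β i :=
    Finset.sum_le_sum_of_subset_of_nonneg hXY fun i _ _ => star_mul_self_nonneg _
  have h6 : 0 ≤ ∑ i ∈ X, star (β i - α i) * (β i - α i) + hInner A (m - n) (m - n) :=
    add_nonneg (Finset.sum_nonneg fun i _ => star_mul_self_nonneg _) (hInner_self_nonneg A _)
  simp only [star_sub, sub_mul, mul_sub, Finset.sum_sub_distrib, hInner_sub_left,
    hInner_sub_right] at h6
  have h7 : ∑ i ∈ X, star (β i) * β i + hInner A m m - g n =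
      ∑ i ∈ X, star (β i) * β i + hInner A m m - g n - g n + g n := by abel
  rw [h3, ← sub_nonneg]
  refine le_trans ?_ (sub_le_sub_right (add_le_add_left h5 _) _)
  rw [h7]
  nth_rewrite 3 [h1]
  nth_rewrite 2 [h2]
  rw [h4]
  convert h6 using 1
  abel

end Positivity

end Resolvent

section Ideal

theorem exists_isLUB_range_of_monotoneComplete {B : Type*} [CStarAlgebra B] [PartialOrder B]
    [StarOrderedRing B] (hB : MonotoneComplete B) {D : Type*} [Preorder D] [IsDirectedOrder D]
    [Nonempty D] {p : D → B} (hp : Monotone p) (hs : ∀ d, IsSelfAdjoint (p d)) {C : ℝ}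
    (hC : ∀ d, ‖p d‖ ≤ C) : ∃ P, IsLUB (Set.range p) P := by
  have hle : ∀ x y : B, cstarLE x y ↔ x ≤ y := fun x y => by
    rw [← sub_nonneg, CStarAlgebra.nonneg_iff_eq_star_mul_self, cstarLE]
  obtain ⟨P, hP⟩ := hB (Set.range p) (Set.range_nonempty p)
    (by rintro _ ⟨d, rfl⟩; exact hs d)
    (by
      rintro _ ⟨d, rfl⟩ _ ⟨e, rfl⟩
      obtain ⟨f, hd, he⟩ := exists_ge_ge d e
      exact ⟨p f, ⟨f, rfl⟩, (hle _ _).2 (hp hd), (hle _ _).2 (hp he)⟩)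
    ⟨C, by rintro _ ⟨d, rfl⟩; exact hC d⟩
  simp only [IsCStarLUB, hle] at hP
  exact ⟨P, hP⟩

variable {A B : Type*} [NonUnitalCStarAlgebra A] [PartialOrder A] [StarOrderedRing A]
  [CStarAlgebra B] [PartialOrder B] [StarOrderedRing B]

open Filter Topology in
/-- A closed ideal contains every element whose absolute value is dominated by an element of the
ideal. -/
theorem exists_apply_eq_of_mul_star_le {φ : A →⋆ₙₐ[ℂ] B} (hφ : Isometry φ)
    (hideal : ∀ a b, ∃ a', φ a' = φ a * b) {T : B} {d : A} (h : T * star T ≤ φ d) :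
    ∃ a, φ a = T := by
  have happ := CStarAlgebra.increasingApproximateUnit A
  have := happ.neBot
  have hlim : Tendsto (fun e : A => φ e * T) (CStarAlgebra.approximateUnit A) (𝓝 T) := by
    rw [tendsto_iff_norm_sub_tendsto_zero]
    have h1 := (tendsto_iff_norm_sub_tendsto_zero.1 (happ.tendsto_mul_right d)).mul_const
      (‖(1 : B)‖ + 1)
    rw [zero_mul] at h1
    have h2 := (Real.continuous_sqrt.tendsto 0).comp h1
    rw [Real.sqrt_zero] at h2
    refine squeeze_zero' (.of_forall fun _ => norm_nonneg _) ?_ h2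
    filter_upwards [happ.eventually_norm] with e he
    refine Real.le_sqrt_of_sq_le ?_
    have h3 : φ e * T - T = (φ e - 1) * T := by rw [sub_mul, one_mul]
    rw [h3, sq, ← CStarRing.norm_self_mul_star, star_mul, mul_assoc, ← mul_assoc T, ← mul_assoc]
    refine (CStarAlgebra.norm_le_norm_of_nonneg_of_le
      (star_right_conjugate_nonneg (mul_star_self_nonneg T) _)
      (star_right_conjugate_le_conjugate h _)).trans ?_
    have h4 : (φ e - 1) * φ d = φ (e * d - d) := by
      rw [map_sub, map_mul, sub_mul, one_mul]
    rw [h4]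
    refine (norm_mul_le _ _).trans ?_
    rw [norm_star]
    have h5 : ∀ a, ‖φ a‖ = ‖a‖ := fun a => by
      simpa using hφ.norm_map_of_map_zero (map_zero φ) a
    refine mul_le_mul (h5 _).le ?_ (norm_nonneg _) (norm_nonneg _)
    have h6 := norm_sub_le (φ e) 1
    rw [h5] at h6
    linarith
  exact hφ.isClosedEmbedding.isClosed_range.mem_of_tendsto hlim
    (.of_forall fun e => hideal e T)

end Ideal

section Multiplier

variable (A : Type*) [NonUnitalCStarAlgebra A]

theorem DoubleCentralizer.isometry_coeHom :
    Isometry (DoubleCentralizer.coeHom : A →⋆ₙₐ[ℂ] 𝓜(ℂ, A)) := by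
  refine AddMonoidHomClass.isometry_of_norm _ fun a => ?_
  rw [← DoubleCentralizer.norm_fst]
  exact ContinuousLinearMap.opNorm_mul_apply ℂ A a

theorem DoubleCentralizer.exists_coeHom_eq_mul (a : A) (b : 𝓜(ℂ, A)) :
    ∃ a', (DoubleCentralizer.coeHom : A →⋆ₙₐ[ℂ] 𝓜(ℂ, A)) a' = DoubleCentralizer.coeHom a * b := by
  refine ⟨b.snd a, DoubleCentralizer.ext _ _ _ _ (Prod.ext ?_ ?_)⟩
  · ext x
    exact b.central a x
  · ext x
    change x * b.snd a = b.snd (x * a)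
    rw [← sub_eq_zero, ← CStarRing.mul_star_self_eq_zero_iff]
    generalize star (x * b.snd a - b.snd (x * a)) = y
    rw [sub_mul, b.central, mul_assoc, b.central, mul_assoc, sub_self]

end Multiplier

section ResolventLimit

variable {A : Type*} [NonUnitalCStarAlgebra A] [PartialOrder A] [StarOrderedRing A]
  {B : Type*} [CStarAlgebra B] [PartialOrder B] [StarOrderedRing B] {φ : A →⋆ₙₐ[ℂ] B}
  {M : Type*} [NormedAddCommGroup M] [NormedSpace ℂ M] [SMul A M] [HilbertCStarModule A M]
  {J : Type*} {v : J → M} {f : M → A} {n : Finset J → M}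

section Existence

variable (hφ : Isometry φ) (hB : MonotoneComplete B)
include hφ hB

theorem exists_mem_orderLimits_of_isResolvent_self (hn : ∀ X, IsResolvent v X f (n X))
    (hf : IsDualVector A f) : ∃ T, (fun X => φ (f (n X)), T) ∈ orderLimits (Finset J) B := by
  have hs : ∀ X, IsSelfAdjoint (φ (f (n X))) := fun X =>
    (IsSelfAdjoint.of_nonneg ((hn X).apply_nonneg hf)).map φ
  have hm : Monotone fun X => φ (f (n X)) := fun X Y h =>
    OrderHomClass.mono φ ((hn X).apply_mono hf (hn Y) h)
  obtain ⟨T, hT⟩ := exists_isLUB_range_of_monotoneComplete hB hm hs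
    (C := dualNorm A f ^ 2) fun X => by
      rw [hφ.norm_map_of_map_zero (map_zero φ)]
      exact (hn X).norm_apply_le hf
  exact ⟨T, mem_orderLimits_of_isLUB hm hs hT⟩

theorem exists_mem_orderLimits_of_isResolvent (hn : ∀ X, IsResolvent v X f (n X))
    (hf : IsDualVector A f) {r : M → A} (hr : IsDualVector A r) :
    ∃ T, (fun X => φ (r (n X)), T) ∈ orderLimits (Finset J) B := by
  choose m hm using fun X => exists_isResolvent v X r
  have h : ∀ c : ℂ, ∃ T, (fun X => φ (f (n X + star c • m X) + c • r (n X + star c • m X)), T) ∈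
      orderLimits (Finset J) B := fun c =>
    exists_mem_orderLimits_of_isResolvent_self hφ hB (fun X => (hn X).add_smul (hm X) c)
      (hf.add_smul hr c)
  choose T hT using h
  have key : ∀ x y : M, r x = (1 / 4 : ℂ) • (f (x + star (1 : ℂ) • y) +
      (1 : ℂ) • r (x + star (1 : ℂ) • y)) -
      (1 / 4 : ℂ) • (f (x + star (-1 : ℂ) • y) + (-1 : ℂ) • r (x + star (-1 : ℂ) • y)) -
      (Complex.I / 4) • (f (x + star Complex.I • y) +
        Complex.I • r (x + star Complex.I • y)) +
      (Complex.I / 4) • (f (x + star (-Complex.I) • y) +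
        (-Complex.I) • r (x + star (-Complex.I) • y)) := by
    intro x y
    simp only [hf.map_add, hr.map_add, hf.map_smulC, hr.map_smulC, star_one, star_neg,
      RCLike.star_def, Complex.conj_I, smul_add, smul_smul]
    match_scalars <;> ring_nf <;> simp <;> ring
  have h4 := add_mem (sub_mem (sub_mem
    ((orderLimits (Finset J) B).smul_mem (1 / 4 : ℂ) (hT 1))
    ((orderLimits (Finset J) B).smul_mem (1 / 4 : ℂ) (hT (-1))))
    ((orderLimits (Finset J) B).smul_mem (Complex.I / 4) (hT Complex.I)))
    ((orderLimits (Finset J) B).smul_mem (Complex.I / 4) (hT (-Complex.I)))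
  refine ⟨(1 / 4 : ℂ) • T 1 - (1 / 4 : ℂ) • T (-1) - (Complex.I / 4) • T Complex.I +
    (Complex.I / 4) • T (-Complex.I), ?_⟩
  convert h4 using 1
  refine Prod.ext (funext fun X => ?_) rfl
  change φ (r (n X)) = _
  rw [key (n X) (m X)]
  simp only [map_add, map_sub, map_smul]
  rfl

end Existence

theorem mul_star_le_of_mem_orderLimits_apply {r : M → A} (hr : IsDualVector A r) {T : B}
    (hT : (fun X => φ (r (n X)), T) ∈ orderLimits (Finset J) B) {z : A}
    (hz : ∀ X, hInner A (n X) (n X) ≤ z) : T * star T ≤ φ (dualNorm A r ^ 2 • z) := by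
  refine mul_star_le_of_mem_orderLimits hT ∅ fun X _ => ?_
  rw [← map_star, ← map_mul]
  refine OrderHomClass.mono φ ((hr.mul_star_le (n X)).trans ?_)
  exact smul_le_smul_of_nonneg_left (hz X) (sq_nonneg _)

variable (φ n) in
/-- `G` is the order limit of the evaluation functionals at the net `n`. -/
def IsResolventLimit (G : (M → A) → A) : Prop :=
  ∀ r, IsDualVector A r → (fun X => φ (r (n X)), φ (G r)) ∈ orderLimits (Finset J) B

theorem exists_isResolventLimit (hφ : Isometry φ) (hB : MonotoneComplete B)
    (hideal : ∀ a b, ∃ a', φ a' = φ a * b) (hn : ∀ X, IsResolvent v X f (n X))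
    (hf : IsDualVector A f) {z : A} (hz : ∀ X, hInner A (n X) (n X) ≤ z) :
    ∃ G, IsResolventLimit φ n G := by
  have h : ∀ r, ∃ a, IsDualVector A r →
      (fun X => φ (r (n X)), φ a) ∈ orderLimits (Finset J) B := by
    intro r
    by_cases hr : IsDualVector A r
    · obtain ⟨T, hT⟩ := exists_mem_orderLimits_of_isResolvent hφ hB hn hf hr
      obtain ⟨a, rfl⟩ := exists_apply_eq_of_mul_star_le hφ hideal
        (mul_star_le_of_mem_orderLimits_apply hr hT hz)
      exact ⟨a, fun _ => hT⟩
    · exact ⟨0, fun h => absurd h hr⟩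
  choose G hG using h
  exact ⟨G, hG⟩

namespace IsResolventLimit

variable {G : (M → A) → A} (hG : IsResolventLimit φ n G) (hφ : Isometry φ)
include hG hφ

theorem norm_mul_apply_le {z : A} (hz : ∀ X, hInner A (n X) (n X) ≤ z) (a : A) {r : M → A}
    (hr : IsDualVector A r) : ‖a * G r‖ ≤ Real.sqrt ‖a * z * star a‖ * dualNorm A r := by
  have h1 := star_right_conjugate_le_conjugate
    (mul_star_le_of_mem_orderLimits_apply hr (hG r hr) hz) (φ a)
  have h2 := CStarAlgebra.norm_le_norm_of_nonneg_of_le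
    (star_right_conjugate_nonneg (mul_star_self_nonneg (φ (G r))) _) h1
  simp only [← map_star, ← map_mul, hφ.norm_map_of_map_zero (map_zero φ)] at h2
  have h3 : a * (G r * star (G r)) * star a = (a * G r) * star (a * G r) := by
    rw [star_mul]; noncomm_ring
  rw [h3, CStarRing.norm_self_mul_star, mul_smul_comm, smul_mul_assoc, norm_smul,
    Real.norm_of_nonneg (sq_nonneg _)] at h2
  refine (sq_le_sq₀ (norm_nonneg _) (mul_nonneg (Real.sqrt_nonneg _) hr.dualNorm_nonneg)).1 ?_
  rw [mul_pow, Real.sq_sqrt (norm_nonneg _), sq]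
  exact h2.trans_eq (mul_comm _ _)

theorem isBidualVector {z : A} (hz : ∀ X, hInner A (n X) (n X) ≤ z) : IsBidualVector A G where
  map_add r s hr hs := by
    have hrs : IsDualVector A fun x => r x + s x := by simpa using hr.add_smul hs 1
    refine hφ.injective (orderLimits_unique (hG _ hrs) ?_)
    convert add_mem (hG r hr) (hG s hs) using 1
    exact Prod.ext (funext fun X => map_add φ _ _) (map_add φ _ _)
  map_smulC c r hr := by
    have h0 : IsDualVector A fun x => r x + (c - 1) • r x := hr.add_smul hr (c - 1)
    have hc : IsDualVector A fun x => c • r x := by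
      convert h0 using 2 with x
      rw [sub_smul, one_smul, add_sub_cancel]
    refine hφ.injective (orderLimits_unique (hG _ hc) ?_)
    convert (orderLimits (Finset J) B).smul_mem c (hG r hr) using 1
    exact Prod.ext (funext fun X => map_smul φ _ _) (map_smul φ _ _)
  map_smulA a r hr := by
    refine hφ.injective (orderLimits_unique (hG _ (hr.mul_star a)) ?_)
    convert mul_right_mem_orderLimits (hG r hr) (φ (star a)) using 1
    exact Prod.ext (funext fun X => map_mul φ _ _) (map_mul φ _ _)
  bound := by
    refine ⟨Real.sqrt ‖z‖, fun r hr => ?_⟩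
    have h1 := CStarAlgebra.norm_le_norm_of_nonneg_of_le (mul_star_self_nonneg (φ (G r)))
      (mul_star_le_of_mem_orderLimits_apply hr (hG r hr) hz)
    rw [CStarRing.norm_self_mul_star, hφ.norm_map_of_map_zero (map_zero φ),
      hφ.norm_map_of_map_zero (map_zero φ), norm_smul, Real.norm_of_nonneg (sq_nonneg _)] at h1
    refine (sq_le_sq₀ (norm_nonneg _)
      (mul_nonneg (Real.sqrt_nonneg _) hr.dualNorm_nonneg)).1 ?_
    rw [mul_pow, Real.sq_sqrt (norm_nonneg _), sq]
    exact h1.trans_eq (mul_comm _ _)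

theorem apply_toDualFun (hn : ∀ X, IsResolvent v X f (n X)) (hf : IsDualVector A f) (j : J)
    (hj : ∀ t : ℝ, ∃ i, v i = (t : ℂ) • v j) : G (toDualFun A (v j)) = star (f (v j)) := by
  refine hφ.injective (orderLimits_eq_of_norm_sub_le (hG _ (isDualVector_toDualFun (v j))) ?_)
  intro ε hε
  set t : ℝ := dualNorm A f / ε + 1 with ht
  have ht0 : 0 < t := by
    have := div_nonneg hf.dualNorm_nonneg hε.le
    positivity
  obtain ⟨i, hi⟩ := hj t
  refine ⟨{i}, fun X hX => ?_⟩
  have h1 := (hn X).norm_sub_le hf (hX (Finset.mem_singleton_self i))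
  rw [hi, hf.map_smulC, hInner_smulC_left, ← smul_sub, norm_smul, Complex.norm_real,
    Real.norm_of_nonneg ht0.le] at h1
  rw [← map_sub, hφ.norm_map_of_map_zero (map_zero φ), toDualFun, ← star_hInner, ← star_sub,
    norm_star, norm_sub_rev]
  refine le_of_mul_le_mul_left (h1.trans ?_) ht0
  rw [ht, add_mul, div_mul_cancel₀ _ hε.ne']
  linarith

end IsResolventLimit

end ResolventLimit

section Bidual

variable {A : Type*} [NonUnitalCStarAlgebra A] {M : Type*} [NormedAddCommGroup M]
  [NormedSpace ℂ M] [SMul A M]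

theorem bidualNorm_le {F : (M → A) → A} {c : ℝ} (hc : 0 ≤ c)
    (h : ∀ r, IsDualVector A r → ‖F r‖ ≤ c * dualNorm A r) : bidualNorm A F ≤ c :=
  csInf_le ⟨0, fun _ hd => hd.1⟩ ⟨hc, h⟩

theorem isBidualVector_omegaFun (x : M) : IsBidualVector A (omegaFun A x) where
  map_add _ _ _ _ := rfl
  map_smulC _ _ _ := rfl
  map_smulA _ _ _ := rfl
  bound := ⟨‖x‖, fun _ hr => (hr.norm_le x).trans_eq (mul_comm _ _)⟩

namespace IsBidualVector

variable {F G : (M → A) → A} (hF : IsBidualVector A F)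
include hF

theorem add (hG : IsBidualVector A G) : IsBidualVector A fun r => F r + G r where
  map_add r s hr hs := by rw [hF.map_add r s hr hs, hG.map_add r s hr hs]; abel
  map_smulC c r hr := by rw [hF.map_smulC c r hr, hG.map_smulC c r hr, smul_add]
  map_smulA a r hr := by rw [hF.map_smulA a r hr, hG.map_smulA a r hr, add_mul]
  bound := by
    obtain ⟨C, hC⟩ := hF.bound
    obtain ⟨D, hD⟩ := hG.bound
    refine ⟨C + D, fun r hr => (norm_add_le _ _).trans ?_⟩
    rw [add_mul]
    exact add_le_add (hC r hr) (hD r hr)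

theorem smulC (c : ℂ) : IsBidualVector A fun r => c • F r where
  map_add r s hr hs := by rw [hF.map_add r s hr hs, smul_add]
  map_smulC d r hr := by rw [hF.map_smulC d r hr, smul_comm]
  map_smulA a r hr := by rw [hF.map_smulA a r hr, smul_mul_assoc]
  bound := by
    obtain ⟨C, hC⟩ := hF.bound
    refine ⟨‖c‖ * C, fun r hr => ?_⟩
    rw [norm_smul, mul_assoc]
    exact mul_le_mul_of_nonneg_left (hC r hr) (norm_nonneg _)

theorem smulA (a : A) : IsBidualVector A fun r => a * F r where
  map_add r s hr hs := by rw [hF.map_add r s hr hs, mul_add]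
  map_smulC d r hr := by rw [hF.map_smulC d r hr, mul_smul_comm]
  map_smulA b r hr := by rw [hF.map_smulA b r hr, mul_assoc]
  bound := by
    obtain ⟨C, hC⟩ := hF.bound
    refine ⟨‖a‖ * C, fun r hr => (norm_mul_le _ _).trans ?_⟩
    rw [mul_assoc]
    exact mul_le_mul_of_nonneg_left (hC r hr) (norm_nonneg _)

variable [HilbertCStarModule A M] [PartialOrder A] [StarOrderedRing A]

/-- The restriction of a bidual vector to the canonical image of the module in its dual. -/
theorem isDualVector_star_apply_toDualFun :
    IsDualVector A fun x => star (F (toDualFun A x)) where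
  map_add x y := by
    rw [← star_add, ← hF.map_add _ _ (isDualVector_toDualFun x) (isDualVector_toDualFun y)]
    congr 2
    exact funext fun z => hInner_add_right z x y
  map_smulC c x := by
    rw [← star_star c, ← star_smul, ← hF.map_smulC _ _ (isDualVector_toDualFun x), star_star]
    congr 2
    exact funext fun z => hInner_smulC_right c z x
  map_smulA a x := by
    rw [← star_star a, ← star_mul, ← hF.map_smulA _ _ (isDualVector_toDualFun x), star_star]
    congr 2
    exact funext fun z => hInner_smulA_right a z x
  bound := by
    obtain ⟨C, hC⟩ := hF.bound
    refine ⟨|C|, fun x => ?_⟩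
    rw [norm_star]
    have h := isDualVector_toDualFun (A := A) x
    calc ‖F (toDualFun A x)‖ ≤ C * dualNorm A (toDualFun A x) := hC _ h
      _ ≤ |C| * dualNorm A (toDualFun A x) :=
        mul_le_mul_of_nonneg_right (le_abs_self C) h.dualNorm_nonneg
      _ ≤ |C| * ‖x‖ := by
        gcongr
        exact dualNorm_toDualFun_le x

end IsBidualVector

namespace IsBidualInnerExtension

variable [HilbertCStarModule A M] {ip : ((M → A) → A) → ((M → A) → A) → A}
  (hip : IsBidualInnerExtension A ip)
include hip

theorem map_add_right {F G H : (M → A) → A} (hF : IsBidualVector A F) (hG : IsBidualVector A G)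
    (hH : IsBidualVector A H) : ip H (fun r => F r + G r) = ip H F + ip H G := by
  rw [hip.conj_symm H _ hH (hF.add hG), hip.map_add_left F G H hF hG hH, star_add,
    ← hip.conj_symm H F hH hF, ← hip.conj_symm H G hH hG]

theorem map_smulA_right (a : A) {F G : (M → A) → A} (hF : IsBidualVector A F)
    (hG : IsBidualVector A G) : ip G (fun r => a * F r) = ip G F * star a := by
  rw [hip.conj_symm G _ hG (hF.smulA a), hip.map_smulA_left a F G hF hG, star_mul,
    ← hip.conj_symm G F hG hF]

theorem map_smulC_right (c : ℂ) {F G : (M → A) → A} (hF : IsBidualVector A F)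
    (hG : IsBidualVector A G) : ip G (fun r => c • F r) = star c • ip G F := by
  rw [hip.conj_symm G _ hG (hF.smulC c), hip.map_smulC_left c F G hF hG, star_smul,
    ← hip.conj_symm G F hG hF]

theorem mem_bidualOrthComp_omegaImage_iff {N : Set M} {K : (M → A) → A} :
    K ∈ bidualOrthComp A ip (omegaImage A N) ↔
      IsBidualVector A K ∧ ∀ x ∈ N, K (toDualFun A x) = 0 := by
  refine and_congr_right fun hK => ⟨fun h x hx => ?_, ?_⟩
  · have h1 := h _ ⟨x, hx, rfl⟩
    rwa [hip.conj_symm K _ hK (isBidualVector_omegaFun x), hip.omega_compat x K hK,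
      star_star] at h1
  · rintro h _ ⟨x, hx, rfl⟩
    rw [hip.conj_symm K _ hK (isBidualVector_omegaFun x), hip.omega_compat x K hK,
      star_star, h x hx]

theorem norm_conjugate_self {F : (M → A) → A} (hF : IsBidualVector A F) (a : A) :
    ‖a * ip F F * star a‖ = bidualNorm A (fun r => a * F r) ^ 2 := by
  rw [hip.norm_compat _ (hF.smulA a), Real.sq_sqrt (norm_nonneg _),
    hip.map_smulA_left a F _ hF (hF.smulA a), hip.map_smulA_right a hF hF, mul_assoc]

variable [PartialOrder A] [StarOrderedRing A]

theorem self_nonneg {F : (M → A) → A} (hF : IsBidualVector A F) : 0 ≤ ip F F := by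
  obtain ⟨b, hb⟩ := hip.self_pos F hF
  rw [hb]
  exact star_mul_self_nonneg b

theorem hInner_self_le_of_le {F : (M → A) → A} (hF : IsBidualVector A F) {n : M}
    (hn : hInner A n n ≤ star (F (toDualFun A n))) : hInner A n n ≤ ip F F := by
  have hΩ := isBidualVector_omegaFun (A := A) n
  have h1 := hip.self_nonneg (hF.add (hΩ.smulC (-1)))
  have h2 : star (F (toDualFun A n)) = F (toDualFun A n) :=
    (IsSelfAdjoint.of_nonneg ((hInner_self_nonneg A n).trans hn)).star_eq ▸ star_star _
  rw [hip.map_add_left _ _ _ hF (hΩ.smulC (-1)) (hF.add (hΩ.smulC (-1))),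
    hip.map_smulC_left _ _ _ hΩ (hF.add (hΩ.smulC (-1))),
    hip.map_add_right hF (hΩ.smulC (-1)) hF, hip.map_add_right hF (hΩ.smulC (-1)) hΩ,
    hip.map_smulC_right (-1) hΩ hF, hip.map_smulC_right (-1) hΩ hΩ,
    hip.conj_symm F _ hF hΩ, hip.omega_compat n F hF, hip.omega_compat n _ hΩ, omegaFun,
    toDualFun, star_hInner] at h1
  simp only [star_neg, star_one, neg_smul, one_smul, star_star, smul_neg, smul_add, neg_neg] at h1
  change 0 ≤ ip F F + -F (toDualFun A n) + (-star (F (toDualFun A n)) + hInner A n n) at h1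
  rw [h2] at h1 hn
  have h3 := add_nonneg h1 (add_nonneg (sub_nonneg.2 hn) (sub_nonneg.2 hn))
  rw [← sub_nonneg]
  convert h3 using 1
  abel

/-- A minimal vector of an affine subspace is orthogonal to the directions of the subspace. -/
theorem eq_zero_of_forall_le {G K : (M → A) → A} (hG : IsBidualVector A G)
    (hK : IsBidualVector A K) (h : ∀ a : A, ip G G ≤ ip (fun r => G r + a * K r)
      (fun r => G r + a * K r)) : ip G K = 0 := by
  set Y := ip G K with hY
  have h1 : ∀ t : ℝ, 0 < t → (2 : ℝ) • (Y * star Y) ≤ t • (Y * ip K K * star Y) := by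
    intro t ht
    have h2 := h (-(t : ℂ) • Y)
    have ha := hK.smulA (-(t : ℂ) • Y)
    rw [hip.map_add_left _ _ _ hG ha (hG.add ha), hip.map_smulA_left _ _ _ hK (hG.add ha),
      hip.map_add_right hG ha hG, hip.map_add_right hG ha hK, hip.map_smulA_right _ hK hG,
      hip.map_smulA_right _ hK hK, hip.conj_symm K G hK hG, ← hY, ← sub_nonneg] at h2
    have h3 : ip G G + Y * star (-(t : ℂ) • Y) + -(t : ℂ) • Y * (star Y + ip K K *
        star (-(t : ℂ) • Y)) - ip G G =
        t • (t • (Y * ip K K * star Y) - (2 : ℝ) • (Y * star Y)) := by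
      simp only [star_smul, star_neg, RCLike.star_def, conj_trivial, neg_smul, mul_neg,
        Complex.coe_smul, mul_smul_comm, smul_mul_assoc, mul_add, smul_add, smul_neg, smul_sub,
        neg_mul, neg_neg, two_smul, ← mul_assoc]
      abel
    rw [h3] at h2
    have h4 := smul_nonneg (inv_nonneg.2 ht.le) h2
    rwa [smul_smul, inv_mul_cancel₀ ht.ne', one_smul, sub_nonneg] at h4
  have h5 : ∀ t : ℝ, 0 < t → 2 * ‖Y * star Y‖ ≤ t * ‖Y * ip K K * star Y‖ := by
    intro t ht
    have h6 := CStarAlgebra.norm_le_norm_of_nonneg_of_le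
      (smul_nonneg zero_le_two (mul_star_self_nonneg Y)) (h1 t ht)
    rwa [norm_smul, norm_smul, Real.norm_of_nonneg ht.le, Real.norm_of_nonneg zero_le_two] at h6
  rw [← CStarRing.mul_star_self_eq_zero_iff, ← norm_eq_zero]
  by_contra h0
  have h7 : 0 < ‖Y * star Y‖ := lt_of_le_of_ne (norm_nonneg _) (Ne.symm h0)
  have h8 := h5 (‖Y * star Y‖ / (‖Y * ip K K * star Y‖ + 1)) (by positivity)
  rw [div_mul_eq_mul_div, le_div_iff₀ (by positivity)] at h8
  nlinarith [norm_nonneg (Y * ip K K * star Y)]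

end IsBidualInnerExtension

end Bidual

/-- Every vector of the bidual has an orthogonal projection to the biorthogonal complement of a
submodule, provided that the coefficients embed as an ideal into a monotone complete algebra. -/
theorem exists_mem_biorthogonal_of_monotoneComplete {A : Type*} [NonUnitalCStarAlgebra A]
    {B : Type*} [CStarAlgebra B] {φ : A →⋆ₙₐ[ℂ] B} (hφ : Isometry φ)
    (hideal : ∀ a b, ∃ a', φ a' = φ a * b) (hB : MonotoneComplete B)
    {M : Type*} [NormedAddCommGroup M] [NormedSpace ℂ M] [SMul A M] [HilbertCStarModule A M]
    {N : Set M} (hN : IsHilbertSubmodule A N) {ip : ((M → A) → A) → ((M → A) → A) → A}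
    (hip : IsBidualInnerExtension A ip) {F : (M → A) → A} (hF : IsBidualVector A F) :
    ∃ G ∈ bidualOrthComp A ip (bidualOrthComp A ip (omegaImage A N)),
      ∀ x ∈ N, G (toDualFun A x) = F (toDualFun A x) := by
  let _ := CStarAlgebra.spectralOrder A
  have _ := CStarAlgebra.spectralOrderedRing A
  let _ := CStarAlgebra.spectralOrder B
  have _ := CStarAlgebra.spectralOrderedRing B
  have hf := hF.isDualVector_star_apply_toDualFun
  choose n hn using fun X => exists_isResolvent ((↑) : N → M) X
    fun x => star (F (toDualFun A x))
  have hnN : ∀ X, n X ∈ N := fun X => by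
    rw [hn X]
    exact Finset.sum_induction _ (· ∈ N) hN.add_mem hN.zero_mem
      fun i _ => hN.smulA_mem _ i.2
  have hle : ∀ F' : (M → A) → A, IsBidualVector A F' →
      (∀ x ∈ N, F' (toDualFun A x) = F (toDualFun A x)) →
      ∀ X, hInner A (n X) (n X) ≤ ip F' F' := fun F' hF' h X =>
    hip.hInner_self_le_of_le hF' (by
      rw [h _ (hnN X)]
      exact (hn X).hInner_self_le hf)
  obtain ⟨G, hG⟩ := exists_isResolventLimit hφ hB hideal hn hf (hle F hF fun _ _ => rfl)
  have hGb := hG.isBidualVector hφ (hle F hF fun _ _ => rfl)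
  have hGN : ∀ x ∈ N, G (toDualFun A x) = F (toDualFun A x) := fun x hx => by
    rw [hG.apply_toDualFun hφ hn hf ⟨x, hx⟩ fun t => ⟨⟨_, hN.smulC_mem (t : ℂ) hx⟩, rfl⟩,
      star_star]
  have hmin : ∀ F' : (M → A) → A, IsBidualVector A F' →
      (∀ x ∈ N, F' (toDualFun A x) = F (toDualFun A x)) → ip G G ≤ ip F' F' := by
    intro F' hF' h
    refine le_of_forall_norm_conjugate_le (hip.self_nonneg hGb) (hip.self_nonneg hF')
      fun a => ?_
    rw [hip.norm_conjugate_self hGb]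
    have h1 := bidualNorm_le (Real.sqrt_nonneg _) fun r hr =>
      hG.norm_mul_apply_le hφ (hle F' hF' h) a hr
    have h2 : 0 ≤ bidualNorm A fun r => a * G r := by
      rw [hip.norm_compat _ (hGb.smulA a)]
      exact Real.sqrt_nonneg _
    exact (pow_le_pow_left₀ h2 h1 2).trans_eq (Real.sq_sqrt (norm_nonneg _))
  refine ⟨G, ⟨hGb, fun K hK => ?_⟩, hGN⟩
  rw [hip.mem_bidualOrthComp_omegaImage_iff] at hK
  refine hip.eq_zero_of_forall_le hGb hK.1 fun a => hmin _ (hGb.add (hK.1.smulA a)) fun x hx => ?_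
  rw [hK.2 x hx, mul_zero, add_zero, hGN x hx]

open scoped MultiplierAlgebra in
/-- If `M(A)` is monotone complete, then for every Hilbert `A`-module `M` and
Hilbert `A`-submodule `N ⊆ M`, the biorthogonal complement `N^⊥⊥` computed in the `A`-bidual
`M''` (w.r.t. Paschke's extended inner product) is an orthogonal direct summand of `M''`:
`M'' = N^⊥⊥ ⊕ (N^⊥⊥)^⊥`. -/
theorem biorthogonal_summand_of_monotoneComplete_multiplier
    (A : Type u) [NonUnitalCStarAlgebra A]
    (hmc : MonotoneComplete 𝓜(ℂ, A))
    (M : Type v) [NormedAddCommGroup M] [NormedSpace ℂ M] [SMul A M] [HilbertCStarModule A M]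
    (N : Set M) (hN : IsHilbertSubmodule A N)
    (ip : ((M → A) → A) → ((M → A) → A) → A)
    (hip : IsBidualInnerExtension A ip) :
    ∀ F : (M → A) → A, IsBidualVector A F →
      ∃ G ∈ bidualOrthComp A ip (bidualOrthComp A ip (omegaImage A N)),
        ∃ H ∈ bidualOrthComp A ip (bidualOrthComp A ip (bidualOrthComp A ip (omegaImage A N))),
          ∀ r : M → A, IsDualVector A r → F r = G r + H r := by
  intro F hF
  obtain ⟨G, hG, hGN⟩ := exists_mem_biorthogonal_of_monotoneComplete
    (DoubleCentralizer.isometry_coeHom A) (DoubleCentralizer.exists_coeHom_eq_mul A) hmc hN hip hF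
  have hH : IsBidualVector A fun r => F r + (-1 : ℂ) • G r := hF.add (hG.1.smulC (-1))
  refine ⟨G, hG, _, ⟨hH, fun K hK => ?_⟩, fun r _ => by simp⟩
  rw [hip.conj_symm _ _ hH hK.1, hK.2 _ (hip.mem_bidualOrthComp_omegaImage_iff.2
    ⟨hH, fun x hx => by simp [hGN x hx]⟩), star_zero]
end
end

section
/- Let A be a C*-algebra and M a Banach A-module (a Banach space with a left A-module structure satisfying ‖a·x‖ ≤ ‖a‖·‖x‖) such that the set A·M = {a·x : a ∈ A, x ∈ M} is norm-dense in M. Then for every x ∈ M and every ε > 0 there exist y ∈ M and a positive element a ∈ A with ‖a‖ ≤ 1 such that x = a·y and ‖x − y‖ < ε. -/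
noncomputable section

open scoped ENNReal MultiplierAlgebra

universe u v w

section Factorization

open Filter Topology NNReal

variable {A : Type*} [NonUnitalCStarAlgebra A]

/-- For `s ≥ 0` and `t > 0` there is a contraction `g` playing the role of `s (t + s)⁻¹`. -/
lemma exists_norm_le_one_smul_add_mul_eq [PartialOrder A] [StarOrderedRing A]
    {s : A} (hs : 0 ≤ s) {t : ℝ} (ht : 0 < t) :
    ∃ g : A, ‖g‖ ≤ 1 ∧ t • g + s * g = s := by
  lift t to ℝ≥0 using ht.le
  rw [NNReal.coe_pos] at ht
  obtain ⟨f, hf, hf₀, hf₁, hfeq⟩ : ∃ f : ℝ≥0 → ℝ≥0, Continuous f ∧ f 0 = 0 ∧ (∀ r, f r ≤ 1) ∧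
      ∀ r, t * f r + r * f r = r := by
    refine ⟨fun r ↦ r / (t + r), ?_, by simp, fun r ↦ div_le_one_of_le₀ le_add_self zero_le,
      fun r ↦ ?_⟩
    · exact continuous_id.div (continuous_const.add continuous_id)
        fun r ↦ (add_pos_of_pos_of_nonneg ht zero_le).ne'
    · rw [← add_mul, mul_div_cancel₀ _ (add_pos_of_pos_of_nonneg ht zero_le).ne']
  have hf' : ContinuousOn f (quasispectrum ℝ≥0 s) := hf.continuousOn
  refine ⟨cfcₙ f s, ?_, ?_⟩
  · rw [← coe_nnnorm, ← NNReal.coe_one, NNReal.coe_le_coe]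
    exact nnnorm_cfcₙ_nnreal_le fun r _ ↦ hf₁ r
  · calc (t : ℝ) • cfcₙ f s + s * cfcₙ f s
        = cfcₙ (fun r ↦ t • f r) s + cfcₙ (fun r ↦ id r * f r) s := by
          rw [cfcₙ_smul t f s hf' hf₀, cfcₙ_mul id f s continuousOn_id rfl hf' hf₀, cfcₙ_id ℝ≥0 s]
          rfl
      _ = cfcₙ (fun r ↦ t • f r + id r * f r) s :=
          (cfcₙ_add (fun r ↦ t • f r) (fun r ↦ id r * f r) s (hf'.const_smul t) (by simp [hf₀])
            (continuousOn_id.mul hf') (by simp)).symm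
      _ = cfcₙ id s := by
          congr 1
          ext1 r
          exact hfeq r
      _ = s := cfcₙ_id ℝ≥0 s

variable {M : Type*} [NormedAddCommGroup M] {φ : A →+ M →+ M}

/-- A contractive biadditive action is jointly continuous. -/
lemma tendsto_action (hφ : ∀ a x, ‖φ a x‖ ≤ ‖a‖ * ‖x‖) {ι : Type*} {l : Filter ι}
    {s : ι → A} {y : ι → M} {a : A} {z : M} (hs : Tendsto s l (𝓝 a)) (hy : Tendsto y l (𝓝 z)) :
    Tendsto (fun i ↦ φ (s i) (y i)) l (𝓝 (φ a z)) := by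
  rw [tendsto_iff_norm_sub_tendsto_zero] at hs ⊢
  have hyz := tendsto_iff_norm_sub_tendsto_zero.mp hy
  refine squeeze_zero (fun _ ↦ norm_nonneg _) (fun i ↦ ?_)
    (g := fun i ↦ ‖s i - a‖ * ‖y i‖ + ‖a‖ * ‖y i - z‖)
    (by simpa using (hs.mul hy.norm).add (hyz.const_mul ‖a‖))
  have h : φ (s i) (y i) - φ a z = φ (s i - a) (y i) + φ a (y i - z) := by simp
  rw [h]
  exact (norm_add_le _ _).trans (add_le_add (hφ _ _) (hφ _ _))

/-- In an essential module over a C⋆-algebra, every vector is nearly fixed by some positive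
contraction. -/
lemma exists_nonneg_norm_le_one_norm_sub_lt [PartialOrder A] [StarOrderedRing A]
    (hφ : ∀ a x, ‖φ a x‖ ≤ ‖a‖ * ‖x‖) (hmul : ∀ a b x, φ (a * b) x = φ a (φ b x))
    (hdense : Dense {y : M | ∃ a x, y = φ a x}) (y : M) {δ : ℝ} (hδ : 0 < δ) :
    ∃ e : A, 0 ≤ e ∧ ‖e‖ ≤ 1 ∧ ‖y - φ e y‖ < δ := by
  obtain ⟨_, hax, a, x, rfl⟩ := Metric.dense_iff.mp hdense y (δ / 3) (by positivity)
  rw [Metric.mem_ball, dist_eq_norm] at hax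
  have hunit := CStarAlgebra.increasingApproximateUnit A
  have hlim : Tendsto (fun e ↦ φ (e * a) x) (CStarAlgebra.approximateUnit A) (𝓝 (φ a x)) :=
    tendsto_action hφ (hunit.tendsto_mul_right a) tendsto_const_nhds
  obtain ⟨e, he₀, he₁, he⟩ := (hunit.eventually_nonneg.and (hunit.eventually_norm.and
    (Metric.tendsto_nhds.mp hlim (δ / 3) (by positivity)))).exists
  rw [dist_eq_norm, hmul] at he
  refine ⟨e, he₀, he₁, ?_⟩
  have hsplit : y - φ e y =
      φ e (φ a x - y) - (φ e (φ a x) - φ a x) - (φ a x - y) := by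
    simp only [map_sub]
    abel
  have hcontr : ‖φ e (φ a x - y)‖ ≤ ‖φ a x - y‖ :=
    (hφ _ _).trans (mul_le_of_le_one_left (norm_nonneg _) he₁)
  rw [hsplit]
  linarith [norm_sub_le (φ e (φ a x - y) - (φ e (φ a x) - φ a x)) (φ a x - y),
    norm_sub_le (φ e (φ a x - y)) (φ e (φ a x) - φ a x)]

variable [NormedSpace ℝ M]

/-- The inductive step of the factorization: an equation `x = (s + t) y` with `t > 0` scalar can be
replaced by one with `t / 2` in place of `t`, moving `s` by at most `t / 2` and `y` by an
arbitrarily small amount. -/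
lemma exists_halved_factorization [PartialOrder A] [StarOrderedRing A]
    (hφ : ∀ a x, ‖φ a x‖ ≤ ‖a‖ * ‖x‖) (hmul : ∀ a b x, φ (a * b) x = φ a (φ b x))
    (hsmul : ∀ (r : ℝ) a x, φ (r • a) x = r • φ a x)
    (hdense : Dense {y : M | ∃ a x, y = φ a x}) {x y : M} {s : A} (hs : 0 ≤ s)
    {t : ℝ} (ht : 0 < t) (hx : φ s y + t • y = x) {δ : ℝ} (hδ : 0 < δ) :
    ∃ (s' : A) (y' : M), 0 ≤ s' ∧ φ s' y' + (t / 2) • y' = x ∧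
      ‖s - s'‖ ≤ t / 2 ∧ ‖y - y'‖ ≤ δ := by
  obtain ⟨e, he₀, he₁, he⟩ :=
    exists_nonneg_norm_le_one_norm_sub_lt hφ hmul hdense y (half_pos hδ)
  have hs' : 0 ≤ s + (t / 2) • e := add_nonneg hs (smul_nonneg (by positivity) he₀)
  obtain ⟨g, hg₁, hg⟩ := exists_norm_le_one_smul_add_mul_eq hs' (half_pos ht)
  set s' := s + (t / 2) • e with hs'_def
  set w := y - φ e y with hw
  have hinv : φ s' (w - φ g w) + (t / 2) • (w - φ g w) = (t / 2) • w := by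
    have h : φ s' w = (t / 2) • φ g w + φ s' (φ g w) := by
      conv_lhs => rw [← hg]
      rw [map_add, AddMonoidHom.add_apply, hsmul, hmul]
    rw [map_sub, h, smul_sub]
    abel
  refine ⟨s', y + (w - φ g w), hs', ?_, ?_, ?_⟩
  · calc φ s' (y + (w - φ g w)) + (t / 2) • (y + (w - φ g w))
        = φ s' y + (t / 2) • y + (φ s' (w - φ g w) + (t / 2) • (w - φ g w)) := by
          rw [map_add, smul_add]
          abel
      _ = x := by
          rw [hinv, hs'_def, hw, ← hx, map_add, AddMonoidHom.add_apply, hsmul]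
          module
  · rw [hs'_def, sub_add_cancel_left, norm_neg, norm_smul, Real.norm_of_nonneg (by positivity)]
    exact mul_le_of_le_one_right (by positivity) he₁
  · have hgw : ‖φ g w‖ ≤ ‖w‖ := (hφ _ _).trans (mul_le_of_le_one_left (norm_nonneg _) hg₁)
    rw [sub_add_cancel_left, norm_neg]
    linarith [norm_sub_le w (φ g w)]

/-- **Cohen factorization** for essential Banach modules over a C⋆-algebra, with a positive
contraction as left factor. -/
theorem exists_nonneg_factorization [PartialOrder A] [StarOrderedRing A] [CompleteSpace M]
    (hφ : ∀ a x, ‖φ a x‖ ≤ ‖a‖ * ‖x‖) (hmul : ∀ a b x, φ (a * b) x = φ a (φ b x))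
    (hsmul : ∀ (r : ℝ) a x, φ (r • a) x = r • φ a x)
    (hdense : Dense {y : M | ∃ a x, y = φ a x}) (x : M) {ε : ℝ} (hε : 0 < ε) :
    ∃ (a : A) (y : M), 0 ≤ a ∧ ‖a‖ ≤ 1 ∧ x = φ a y ∧ ‖x - y‖ ≤ ε := by
  let P : ℕ → A × M → Prop := fun n p ↦ 0 ≤ p.1 ∧ φ p.1 p.2 + (1 / 2 ^ n : ℝ) • p.2 = x
  have hstep (n : ℕ) (p : A × M) : ∃ q : A × M, P n p → P (n + 1) q ∧
      ‖p.1 - q.1‖ ≤ 1 / 2 / 2 ^ n ∧ ‖p.2 - q.2‖ ≤ ε / 2 / 2 ^ n := by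
    by_cases hp : P n p
    · obtain ⟨s', y', h₀, h₁, h₂, h₃⟩ := exists_halved_factorization hφ hmul hsmul hdense hp.1
        (by positivity) hp.2 (show 0 < ε / 2 / 2 ^ n by positivity)
      refine ⟨(s', y'), fun _ ↦ ⟨⟨h₀, ?_⟩, ?_, h₃⟩⟩
      · rwa [pow_succ, ← div_div]
      · rwa [div_right_comm]
    · exact ⟨p, fun h ↦ absurd h hp⟩
  choose f hf using hstep
  let u : ℕ → A × M := fun n ↦ Nat.rec (0, x) f n
  have hP (n : ℕ) : P n (u n) := by
    induction n with
    | zero => exact ⟨le_rfl, by simp [u]⟩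
    | succ n ih => exact (hf n _ ih).1
  have hs (n : ℕ) : dist (u n).1 (u (n + 1)).1 ≤ 1 / 2 / 2 ^ n := by
    rw [dist_eq_norm]
    exact (hf n _ (hP n)).2.1
  have hy (n : ℕ) : dist (u n).2 (u (n + 1)).2 ≤ ε / 2 / 2 ^ n := by
    rw [dist_eq_norm]
    exact (hf n _ (hP n)).2.2
  obtain ⟨a, ha⟩ := cauchySeq_tendsto_of_complete (cauchySeq_of_le_geometric_two hs)
  obtain ⟨y, hyl⟩ := cauchySeq_tendsto_of_complete (cauchySeq_of_le_geometric_two hy)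
  refine ⟨a, y, ?_, ?_, ?_, ?_⟩
  · exact CStarAlgebra.isClosed_nonneg.mem_of_tendsto ha (.of_forall fun n ↦ (hP n).1)
  · simpa [u] using dist_le_of_le_geometric_two_of_tendsto₀ hs ha
  · have hpow : Tendsto (fun n : ℕ ↦ (1 / 2 ^ n : ℝ)) atTop (𝓝 0) := by
      simpa using tendsto_pow_atTop_nhds_zero_of_lt_one (r := (1 / 2 : ℝ)) (by norm_num)
        (by norm_num)
    have hlim := (tendsto_action hφ ha hyl).add (hpow.smul hyl)
    simp only [(hP _).2, zero_smul, add_zero] at hlim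
    exact tendsto_nhds_unique tendsto_const_nhds hlim
  · rw [← dist_eq_norm]
    exact dist_le_of_le_geometric_two_of_tendsto₀ hy hyl

end Factorization

/-- STATEMENT 8: In a Banach `A`-module `M` with `A • M` dense, every element `x` factors as
`x = a • y` with `a` positive of norm at most one, and `y` close to `x`. -/
theorem banachModule_positive_factorization
    (A : Type u) [NonUnitalCStarAlgebra A]
    (M : Type v) [NormedAddCommGroup M] [NormedSpace ℂ M] [CompleteSpace M] [SMul A M]
    (hsmul_add : ∀ (a : A) (x y : M), a • (x + y) = a • x + a • y)
    (hadd_smul : ∀ (a b : A) (x : M), (a + b) • x = a • x + b • x)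
    (hmul_smul : ∀ (a b : A) (x : M), (a * b) • x = a • (b • x))
    (hsmul_smul : ∀ (c : ℂ) (a : A) (x : M), (c • a) • x = c • (a • x))
    (hnorm_smul : ∀ (a : A) (x : M), ‖a • x‖ ≤ ‖a‖ * ‖x‖)
    (hdense : Dense {y : M | ∃ (a : A) (x : M), y = a • x}) :
    ∀ (x : M) (ε : ℝ), 0 < ε →
      ∃ (a : A) (y : M), (∃ b : A, a = star b * b) ∧ ‖a‖ ≤ 1 ∧ x = a • y ∧ ‖x - y‖ < ε := by
  intro x ε hε
  let _ : PartialOrder A := CStarAlgebra.spectralOrder A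
  have _ : StarOrderedRing A := CStarAlgebra.spectralOrderedRing A
  let φ : A →+ M →+ M := AddMonoidHom.mk' (fun a ↦ AddMonoidHom.mk' (a • ·) (hsmul_add a))
    fun a b ↦ AddMonoidHom.ext (hadd_smul a b)
  obtain ⟨a, y, ha₀, ha₁, hxy, hlt⟩ := exists_nonneg_factorization (φ := φ) hnorm_smul hmul_smul
    (fun r a z ↦ hsmul_smul r a z) hdense x (half_pos hε)
  exact ⟨a, y, CStarAlgebra.nonneg_iff_eq_star_mul_self.mp ha₀, ha₁, hxy,
    hlt.trans_lt (half_lt_self hε)⟩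
end
end
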